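/- arXiv:2506.01528 — 2 statements merged into one kernel-verified Lean document; each statement's English description precedes it below -/
import Mathlib

section
/- Let (K,|·|) be a non-Archimedean nontrivially valued field, n ≥ 2 and ε ∈ (0,1]. Then every nonempty subset E ⊆ K^n that is invariant under the action of SA(n,D_K,ε) is SA(n,D_K,ε)-paradoxical using four pieces. -/
/-- `v` is a non-Archimedean valuation on the field `K`: it is nonnegative, vanishes
exactly at `0`, is multiplicative, and satisfies the strong triangle inequality. -/
def IsNAVal {K : Type*} [Field K] (v : K → ℝ) : Prop :=
  (∀ x, 0 ≤ v x) ∧ (∀ x, v x = 0 ↔ x = 0) ∧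
    (∀ x y, v (x * y) = v x * v y) ∧ (∀ x y, v (x + y) ≤ max (v x) (v y))

/-- `f ∈ SA(n, D_K, ε)`: `f` is the affine map `x ↦ A x + τ` with
`A ∈ SL(n, D_K, ε)` and `τ ∈ D_K^n` with `v (τ i) ≤ ε` for all `i`. -/
def MemSAe {K : Type*} [Field K] (v : K → ℝ) (ε : ℝ) {n : ℕ}
    (f : (Fin n → K) → Fin n → K) : Prop :=
  ∃ (A : Matrix (Fin n) (Fin n) K) (τ : Fin n → K),
    (∀ i j, v (A i j) ≤ 1) ∧ A.det = 1 ∧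
    (∀ i j, v (A i j - (1 : Matrix (Fin n) (Fin n) K) i j) ≤ ε) ∧
    (∀ i, v (τ i) ≤ 1) ∧ (∀ i, v (τ i) ≤ ε) ∧ ∀ x, f x = A.mulVec x + τ

/-- A nonempty set `E ⊆ X` is paradoxical using `r` pieces with respect to the
set `S` of transformations of `X`: there are `m, k ≥ 1` with `m + k = r`,
pairwise disjoint pieces `A₁, …, A_m, B₁, …, B_k ⊆ E` covering `E`, and
transformations `g i, h j ∈ S` such that the images `g i '' A i` partition `E`
and the images `h j '' B j` partition `E`. -/
def ParadoxicalUsing {X : Type*} (S : Set (X → X)) (E : Set X) (r : ℕ) : Prop :=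
  ∃ (m k : ℕ), 1 ≤ m ∧ 1 ≤ k ∧ m + k = r ∧
    ∃ (A : Fin m → Set X) (B : Fin k → Set X) (g : Fin m → X → X) (h : Fin k → X → X),
      (∀ i, g i ∈ S) ∧ (∀ j, h j ∈ S) ∧
      (∀ i, A i ⊆ E) ∧ (∀ j, B j ⊆ E) ∧
      (∀ i i', i ≠ i' → Disjoint (A i) (A i')) ∧
      (∀ j j', j ≠ j' → Disjoint (B j) (B j')) ∧
      (∀ i j, Disjoint (A i) (B j)) ∧
      ((⋃ i, A i) ∪ ⋃ j, B j) = E ∧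
      (∀ i i', i ≠ i' → Disjoint (g i '' A i) (g i' '' A i')) ∧
      (⋃ i, g i '' A i) = E ∧
      (∀ j j', j ≠ j' → Disjoint (h j '' B j) (h j' '' B j')) ∧
      (⋃ j, h j '' B j) = E


noncomputable section StatementEightAux

open Finset

def wt8 {Γ : Type*} [LinearOrder Γ] (a b : Γ) : ℕ := if b < a then 2 else if b = a then 1 else 0

lemma wt8_add {Γ : Type*} [LinearOrder Γ] (a b : Γ) : wt8 a b + wt8 b a = 2 := by
  unfold wt8
  rcases lt_trichotomy a b with h | h | h
  · simp [h, h.not_gt, h.ne']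
  · simp [h]
  · simp [h, h.not_gt, h.ne']

lemma matching8 {X : Type*} {Γ : Type*} [LinearOrder Γ] (γ : Bool → Equiv.Perm X) (h : X → Γ)
    (H : ∀ x, ∑ c : Bool, (wt8 (h x) (h (γ c x)) + wt8 (h x) (h ((γ c).symm x))) ≤ 2) :
    ∃ φ : X → X × Bool, Function.Bijective φ ∧
      ∀ x, x = (φ x).1 ∨ x = γ (φ x).2 (φ x).1 := by
  classical
  let t : X × Bool → Finset X := fun e => {e.1, γ e.2 e.1}
  have hall : ∀ F : Finset (X × Bool), #F ≤ #(F.biUnion t) := by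
    intro F
    set V := F.biUnion t with hV
    have h1 : 2 * #F = ∑ e ∈ F, wt8 (h e.1) (h (γ e.2 e.1)) +
        ∑ e ∈ F, wt8 (h (γ e.2 e.1)) (h e.1) := by
      rw [← Finset.sum_add_distrib]
      simp [wt8_add, mul_comm]
    have h2 : ∑ e ∈ F, wt8 (h e.1) (h (γ e.2 e.1)) ≤
        ∑ e ∈ V ×ˢ (univ : Finset Bool), wt8 (h e.1) (h (γ e.2 e.1)) := by
      apply Finset.sum_le_sum_of_subset
      intro e he
      simp only [mem_product, mem_univ, and_true, hV, mem_biUnion]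
      exact ⟨e, he, by simp [t]⟩
    have h3 : ∑ e ∈ F, wt8 (h (γ e.2 e.1)) (h e.1) ≤
        ∑ e ∈ V ×ˢ (univ : Finset Bool), wt8 (h e.1) (h ((γ e.2).symm e.1)) := by
      let k : X × Bool → X × Bool := fun e => (γ e.2 e.1, e.2)
      have hk : Function.Injective k := by
        rintro ⟨x, c⟩ ⟨y, d⟩ hxy
        simp only [k, Prod.mk.injEq] at hxy
        obtain ⟨h1, rfl⟩ := hxy
        simpa using h1
      have : ∑ e ∈ F, wt8 (h (γ e.2 e.1)) (h e.1) =
          ∑ e ∈ F.image k, wt8 (h e.1) (h ((γ e.2).symm e.1)) := by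
        rw [Finset.sum_image (fun a _ b _ hab => hk hab)]
        simp [k]
      rw [this]
      apply Finset.sum_le_sum_of_subset
      intro e he
      obtain ⟨e', he', rfl⟩ := Finset.mem_image.1 he
      simp only [mem_product, mem_univ, and_true, hV, mem_biUnion]
      exact ⟨e', he', by simp [t, k]⟩
    have h4 : ∑ e ∈ V ×ˢ (univ : Finset Bool), wt8 (h e.1) (h (γ e.2 e.1)) +
        ∑ e ∈ V ×ˢ (univ : Finset Bool), wt8 (h e.1) (h ((γ e.2).symm e.1)) ≤ 2 * #V := by
      rw [← Finset.sum_add_distrib, Finset.sum_product]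
      calc _ ≤ ∑ x ∈ V, 2 := Finset.sum_le_sum (fun x _ => H x)
        _ = _ := by simp [mul_comm]
    omega
  obtain ⟨g, hg, hgt⟩ := (Finset.all_card_le_biUnion_card_iff_exists_injective t).1 hall
  have hf : Function.Injective (fun x : X => (x, true)) := fun x y hxy => by simpa using hxy
  obtain ⟨φ, hφ, hR⟩ := Function.Embedding.schroeder_bernstein_of_rel hf hg
    (fun x e => x = e.1 ∨ x = γ e.2 e.1) (fun x => Or.inl rfl)
    (fun e => by simpa [t] using hgt e)
  exact ⟨φ, hφ, hR⟩

lemma half8 {X : Type*} (E : Set X) (φ : E → E × Bool) (hφ : Function.Bijective φ) (c : Bool)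
    (f : X → X) (γ : E → E) (hγ : Function.Bijective γ) (hf : ∀ x : E, f x = γ x)
    (hR : ∀ x, (φ x).2 = c → (x = (φ x).1 ∨ x = γ (φ x).1)) :
    ∃ P Q : Set X, Disjoint P Q ∧ P ∪ Q = {x | ∃ hx : x ∈ E, (φ ⟨x, hx⟩).2 = c} ∧
      Disjoint (id '' P) (f '' Q) ∧ id '' P ∪ f '' Q = E := by
  refine ⟨{x | ∃ hx : x ∈ E, (φ ⟨x, hx⟩).2 = c ∧ (φ ⟨x, hx⟩).1 ≠ ⟨x, hx⟩},
    {x | ∃ hx : x ∈ E, (φ ⟨x, hx⟩).2 = c ∧ (φ ⟨x, hx⟩).1 = ⟨x, hx⟩}, ?_, ?_, ?_, ?_⟩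
  · rw [Set.disjoint_left]
    rintro x ⟨hx, h1, h2⟩ ⟨_, h3, h4⟩
    exact h2 h4
  · ext x
    simp only [Set.mem_union, Set.mem_ofPred_eq]
    constructor
    · rintro (⟨hx, h1, _⟩ | ⟨hx, h1, _⟩) <;> exact ⟨hx, h1⟩
    · rintro ⟨hx, h1⟩
      by_cases h : (φ ⟨x, hx⟩).1 = ⟨x, hx⟩
      · exact Or.inr ⟨hx, h1, h⟩
      · exact Or.inl ⟨hx, h1, h⟩
  · rw [Set.disjoint_left]
    rintro _ ⟨x, ⟨hx, h1, h2⟩, rfl⟩ ⟨y, ⟨hy, h3, h4⟩, h5⟩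
    have h5' : γ ⟨y, hy⟩ = ⟨x, hx⟩ := Subtype.ext (by rw [← hf]; exact h5)
    rcases hR _ h1 with h6 | h6
    · exact h2 h6.symm
    · have h7 : (φ ⟨x, hx⟩).1 = ⟨y, hy⟩ := hγ.1 (by rw [← h6, h5'])
      have h8 : φ ⟨x, hx⟩ = φ ⟨y, hy⟩ := Prod.ext (by rw [h7, h4]) (by rw [h1, h3])
      have h9 := hφ.1 h8
      exact h2 (by rw [h7, h9])
  · ext x
    simp only [Set.image_id, Set.mem_union, Set.mem_image, Set.mem_ofPred_eq]
    constructor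
    · rintro (⟨hx, _⟩ | ⟨y, ⟨hy, _⟩, rfl⟩)
      · exact hx
      · rw [hf ⟨y, hy⟩]; exact (γ ⟨y, hy⟩).2
    · intro hx
      obtain ⟨y, hy⟩ := hγ.2 ⟨x, hx⟩
      obtain ⟨z, hz⟩ := hφ.2 (y, c)
      have hz2 : (φ z).2 = c := by rw [hz]
      have hz1 : (φ z).1 = y := by rw [hz]
      by_cases h : (φ z).1 = z
      · right
        refine ⟨z, ⟨z.2, hz2, h⟩, ?_⟩
        rw [hf, ← h, hz1, hy]
      · left
        rcases hR z hz2 with h6 | h6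
        · exact absurd h6.symm h
        · rw [hz1, hy] at h6
          subst h6
          exact ⟨hx, hz2, h⟩

lemma paradox8 {X : Type*} (S : Set (X → X)) (E : Set X) {Γ : Type*} [LinearOrder Γ]
    (h : X → Γ) (a b : X → X) (hid : id ∈ S) (ha : a ∈ S) (hb : b ∈ S)
    (hai : Function.Injective a) (hbi : Function.Injective b) (haE : a '' E = E) (hbE : b '' E = E)
    (H : ∀ x a' b', a a' = x → b b' = x → wt8 (h x) (h (a x)) + wt8 (h x) (h a') +
      (wt8 (h x) (h (b x)) + wt8 (h x) (h b')) ≤ 2) :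
    ParadoxicalUsing S E 4 := by
  have mk : ∀ f : X → X, Function.Injective f → f '' E = E →
      ∃ γ : Equiv.Perm E, ∀ x : E, f x = γ x := by
    intro f hf hE
    have hb : Set.BijOn f E E := by
      refine ⟨fun x hx => hE ▸ Set.mem_image_of_mem f hx, hf.injOn, ?_⟩
      intro x hx
      rw [hE]; exact hx
    exact ⟨hb.equiv f, fun x => rfl⟩
  obtain ⟨α, hα⟩ := mk a hai haE
  obtain ⟨β, hβ⟩ := mk b hbi hbE
  obtain ⟨φ, hφ, hR⟩ := matching8 (fun c : Bool => if c then α else β) (fun x : E => h x) (by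
    intro x
    have := H x (α.symm x) (β.symm x) (by rw [hα]; simp) (by rw [hβ]; simp)
    simpa [hα, hβ] using this)
  obtain ⟨P, Q, h1, h2, h3, h4⟩ := half8 E φ hφ true a α α.bijective hα (by
    intro x hx
    have := hR x
    simpa [hx] using this)
  obtain ⟨P', Q', h1', h2', h3', h4'⟩ := half8 E φ hφ false b β β.bijective hβ (by
    intro x hx
    have := hR x
    simpa [hx] using this)
  have hd : Disjoint (P ∪ Q) (P' ∪ Q') := by
    rw [h2, h2', Set.disjoint_left]
    rintro x ⟨hx, h⟩ ⟨_, h'⟩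
    rw [h] at h'; cases h'
  have hu : (P ∪ Q) ∪ (P' ∪ Q') = E := by
    rw [h2, h2']
    ext x
    constructor
    · rintro (⟨hx, _⟩ | ⟨hx, _⟩) <;> exact hx
    · intro hx
      cases hc : (φ ⟨x, hx⟩).2
      · exact Or.inr ⟨hx, hc⟩
      · exact Or.inl ⟨hx, hc⟩
  simp only [Set.disjoint_union_left, Set.disjoint_union_right] at hd
  have union2 : ∀ s : Fin 2 → Set X, (⋃ i, s i) = s 0 ∪ s 1 := by
    intro s; ext x; simp [Fin.exists_fin_two]
  refine ⟨2, 2, by norm_num, by norm_num, by norm_num, ![P, Q], ![P', Q'], ![id, a], ![id, b],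
    ?_, ?_, ?_, ?_, ?_, ?_, ?_, ?_, ?_, ?_, ?_, ?_⟩
  · simp [Fin.forall_fin_two, hid, ha]
  · simp [Fin.forall_fin_two, hid, hb]
  · rw [Fin.forall_fin_two, ← hu]
    exact ⟨fun x hx => Or.inl (Or.inl hx), fun x hx => Or.inl (Or.inr hx)⟩
  · rw [Fin.forall_fin_two, ← hu]
    exact ⟨fun x hx => Or.inr (Or.inl hx), fun x hx => Or.inr (Or.inr hx)⟩
  · simp [Fin.forall_fin_two, h1, h1.symm]
  · simp [Fin.forall_fin_two, h1', h1'.symm]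
  · simp [Fin.forall_fin_two, hd]
  · rw [union2, union2]; exact hu
  · simpa [Fin.forall_fin_two, h3, disjoint_comm] using h3
  · rw [union2]; exact h4
  · simpa [Fin.forall_fin_two, h3', disjoint_comm] using h3'
  · rw [union2]; exact h4'

lemma val_basic8 {K : Type*} [Field K] (v : K → ℝ) (hv : IsNAVal v) :
    v 0 = 0 ∧ v 1 = 1 ∧ (∀ x, v (-x) = v x) ∧ (∀ x, v x⁻¹ = (v x)⁻¹) ∧
    (∀ x (k : ℕ), v (x ^ k) = v x ^ k) ∧ (∀ z : ℤ, v z ≤ 1) ∧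
    (∀ x, v x < 1 → v (1 + x) = 1) := by
  obtain ⟨h0, hz, hm, ha⟩ := hv
  have v0 : v 0 = 0 := (hz 0).2 rfl
  have v1 : v 1 = 1 := by
    have h := hm 1 1
    rw [mul_one] at h
    have h' : v 1 ≠ 0 := fun h => one_ne_zero ((hz 1).1 h)
    exact (mul_left_cancel₀ h' (by rw [mul_one]; exact h)).symm
  have vm1 : v (-1) = 1 := by
    have h := hm (-1) (-1)
    rw [neg_mul_neg, one_mul, v1] at h
    have := h0 (-1)
    nlinarith
  have vn : ∀ x, v (-x) = v x := fun x => by rw [← neg_one_mul, hm, vm1, one_mul]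
  have vinv : ∀ x, v x⁻¹ = (v x)⁻¹ := by
    intro x
    by_cases hx : x = 0
    · simp [hx, v0]
    · apply eq_inv_of_mul_eq_one_left
      rw [← hm, inv_mul_cancel₀ hx, v1]
  have vp : ∀ x (k : ℕ), v (x ^ k) = v x ^ k := by
    intro x k
    induction k with
    | zero => simp [v1]
    | succ k ih => rw [pow_succ, hm, ih, pow_succ]
  have vnat : ∀ n : ℕ, v n ≤ 1 := by
    intro n
    induction n with
    | zero => simp [v0]
    | succ k ih =>
      push_cast
      exact (ha _ _).trans (max_le ih v1.le)
  refine ⟨v0, v1, vn, vinv, vp, ?_, ?_⟩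
  · intro z
    rcases Int.eq_nat_or_neg z with ⟨n, rfl | rfl⟩
    · simpa using vnat n
    · simpa [vn] using vnat n
  · intro x hx
    apply le_antisymm ((ha _ _).trans (max_le v1.le hx.le))
    by_contra hlt
    push Not at hlt
    have h := ha (1 + x) (-x)
    rw [add_neg_cancel_right, v1, vn] at h
    exact absurd h (not_le.2 (max_lt hlt hx))

lemma exists_int8 {K : Type*} [Field K] (v : K → ℝ) (hv : IsNAVal v) (t : K) (ht0 : t ≠ 0)
    (ht : v t < 1) (p : Polynomial ℤ) :
    v (Polynomial.aeval t p) ≤ 1 ∧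
    (p.map (Int.castRingHom K) ≠ 0 → Polynomial.aeval t p = 0 → ∃ c : ℤ, (c : K) ≠ 0 ∧ v c < 1) := by
  obtain ⟨v0, v1, vn, vinv, vp, vz, va⟩ := val_basic8 v hv
  obtain ⟨h0, hz, hm, ha⟩ := hv
  induction p using Polynomial.recOnHorner with
  | M0 => simp [v0]
  | MC p a hp0 ha0 ih =>
    constructor
    · simp only [map_add, Polynomial.aeval_C]
      exact (ha _ _).trans (max_le ih.1 (by simpa using vz a))
    · intro h1 h2
      by_cases hc : (a : K) = 0
      · apply ih.2
        · intro h; apply h1; rw [Polynomial.map_add, h, Polynomial.map_C, eq_intCast, hc]; simp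
        · simpa [hc] using h2
      · refine ⟨a, hc, ?_⟩
        have hX : p = Polynomial.divX p * Polynomial.X := by
          conv_lhs => rw [← Polynomial.divX_mul_X_add p, hp0]
          simp
        -- need bound for divX
        have hb : ∀ q : Polynomial ℤ, v (Polynomial.aeval t q) ≤ 1 := by
          intro q
          induction q using Polynomial.recOnHorner with
          | M0 => simp [v0]
          | MC q a _ _ ih =>
            simp only [map_add, Polynomial.aeval_C]
            exact (ha _ _).trans (max_le ih (by simpa using vz a))
          | MX q _ ih =>
            simp only [map_mul, Polynomial.aeval_X, hm]
            exact mul_le_one₀ ih (h0 _) ht.le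
        have : (a : K) = -(Polynomial.aeval t (Polynomial.divX p) * t) := by
          rw [hX] at h2
          simp only [map_add, map_mul, Polynomial.aeval_X, Polynomial.aeval_C] at h2
          simp only [algebraMap_int_eq, eq_intCast] at h2
          linear_combination h2
        rw [this, vn, hm]
        have := hb (Polynomial.divX p)
        have := h0 t
        nlinarith
  | MX p hp ih =>
    constructor
    · simp only [map_mul, Polynomial.aeval_X, hm]
      exact mul_le_one₀ ih.1 (h0 _) ht.le
    · intro h1 h2
      apply ih.2
      · intro h; apply h1; simp [h]
      · simpa [ht0] using h2

lemma exists_s8 {K : Type*} [Field K] (v : K → ℝ) (hv : IsNAVal v)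
    (hnt : ∃ x : K, x ≠ 0 ∧ v x ≠ 1) (ε : ℝ) (hε0 : 0 < ε) :
    ∃ s : K, v s < 1 ∧ v s ≤ ε ∧ ¬ IsIntegral ℤ s := by
  have hv' := hv
  obtain ⟨v0, v1, vn, vinv, vp, vz, va⟩ := val_basic8 v hv
  obtain ⟨h0, hz, hm, ha⟩ := hv
  obtain ⟨t, ht0, ht⟩ : ∃ t : K, t ≠ 0 ∧ v t < 1 := by
    obtain ⟨x, hx, hx1⟩ := hnt
    rcases lt_or_gt_of_ne hx1 with h | h
    · exact ⟨x, hx, h⟩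
    · exact ⟨x⁻¹, inv_ne_zero hx, by rw [vinv]; exact inv_lt_one_of_one_lt₀ h⟩
  have hpow : ∀ t : K, v t < 1 → ∃ k : ℕ, 0 < k ∧ v t ^ k < 1 ∧ v t ^ k ≤ ε := by
    intro t ht
    obtain ⟨k, hk⟩ := exists_pow_lt_of_lt_one hε0 ht
    refine ⟨k + 1, k.succ_pos, pow_lt_one₀ (h0 t) ht k.succ_ne_zero, ?_⟩
    rw [pow_succ]
    have := pow_nonneg (h0 t) k
    have := h0 t
    nlinarith
  by_cases hint : IsIntegral ℤ t
  · obtain ⟨p, hp, hpt⟩ := hint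
    obtain ⟨c, hc, hvc⟩ := (exists_int8 v hv' t ht0 ht p).2
      (by exact (hp.map (Int.castRingHom K)).ne_zero) hpt
    have hchar : CharZero K := by
      obtain ⟨q, hq⟩ := CharP.exists K
      rcases CharP.char_is_prime_or_zero K q with hqp | rfl
      · exfalso
        have := Fact.mk hqp
        have h1 : (c : ZMod q) ≠ 0 := by
          rw [Ne, ZMod.intCast_zmod_eq_zero_iff_dvd]
          rwa [Ne, CharP.intCast_eq_zero_iff K q] at hc
        have h2 := ZMod.pow_card_sub_one_eq_one h1
        have h3 := congrArg (ZMod.castHom (dvd_refl q) K) h2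
        simp only [map_pow, map_intCast, map_one] at h3
        have h4 := congrArg v h3
        rw [vp, v1] at h4
        have : q - 1 ≠ 0 := by have := hqp.two_le; omega
        exact absurd h4 (pow_lt_one₀ (h0 _) hvc this).ne
      · exact CharP.charP_to_charZero K
    obtain ⟨k, hk0, hk1, hk2⟩ := hpow c hvc
    have hden : v (1 + (c : K) ^ 2) = 1 := va _ (by rw [vp]; exact pow_lt_one₀ (h0 _) hvc two_ne_zero)
    have hvs : v ((c : K) ^ k / (1 + (c : K) ^ 2)) = v c ^ k := by
      rw [div_eq_mul_inv, hm, vinv, hden, vp]; simp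
    refine ⟨(c : K) ^ k / (1 + (c : K) ^ 2), by rw [hvs]; exact hk1, by rw [hvs]; exact hk2, ?_⟩
    intro hI
    have hc0 : c ≠ 0 := fun h => hc (by simp [h])
    have hcast : (c : K) ^ k / (1 + (c : K) ^ 2) =
        algebraMap ℚ K ((c : ℚ) ^ k / (1 + (c : ℚ) ^ 2)) := by simp
    rw [hcast, isIntegral_algebraMap_iff (algebraMap ℚ K).injective] at hI
    obtain ⟨z, hz⟩ := IsIntegrallyClosed.isIntegral_iff.1 hI
    have hne : (1 + (c : ℚ) ^ 2) ≠ 0 := by positivity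
    rw [eq_div_iff hne] at hz
    have hz' : z * (1 + c ^ 2) = c ^ k := by
      simp only [algebraMap_int_eq, eq_intCast] at hz
      exact_mod_cast hz
    have hcop : IsCoprime (1 + c ^ 2) (c ^ k) := by
      apply IsCoprime.pow_right
      exact ⟨1, -c, by ring⟩
    have hu : IsUnit (1 + c ^ 2) := hcop.isUnit_of_dvd' dvd_rfl ⟨z, by rw [← hz']; ring⟩
    rcases Int.isUnit_iff.1 hu with h | h
    · apply hc0; simpa using h
    · nlinarith [sq_nonneg c]
  · obtain ⟨k, hk0, hk1, hk2⟩ := hpow t ht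
    exact ⟨t ^ k, by rw [vp]; exact hk1, by rw [vp]; exact hk2, fun h => hint (h.of_pow hk0)⟩

lemma exists_W8 {K : Type*} [Field K] (s : K) (hs : ¬ IsIntegral ℤ s) :
    ∃ W : ValuationSubring K, s ∉ W := by
  have : IsIntegrallyClosedIn (integralClosure ℤ K).toSubring K := by
    rw [Subring.isIntegrallyClosedIn_iff]
    intro x hx
    exact isIntegral_trans (R := ℤ) (A := integralClosure ℤ K) x hx
  obtain ⟨V, _, hV⟩ := Subring.exists_le_valuationSubring_of_isIntegrallyClosedIn
    (R := (integralClosure ℤ K).toSubring) (x := s) hs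
  exact ⟨V, hV⟩

lemma wt_sum8 {Γ : Type*} [LinearOrder Γ] (o h h1 h2 h3 h4 : Γ) (T1 T2 T3 T4 : Prop)
    (l0 : o ≤ h) (l1 : o ≤ h1) (l2 : o ≤ h2) (l3 : o ≤ h3) (l4 : o ≤ h4)
    (t1 : h1 ≤ h → T1) (t2 : h2 ≤ h → T2) (t3 : h3 ≤ h → T3) (t4 : h4 ≤ h → T4)
    (p12 : o < h → T1 → T2 → False) (p13 : o < h → T1 → T3 → False)
    (p14 : o < h → T1 → T4 → False) (p23 : o < h → T2 → T3 → False)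
    (p24 : o < h → T2 → T4 → False) (p34 : o < h → T3 → T4 → False)
    (q123 : o = h → T1 → T2 → T3 → False) (q124 : o = h → T1 → T2 → T4 → False)
    (q134 : o = h → T1 → T3 → T4 → False) (q234 : o = h → T2 → T3 → T4 → False) :
    wt8 h h1 + wt8 h h2 + (wt8 h h3 + wt8 h h4) ≤ 2 := by
  classical
  have key : ∀ k : Γ, ∀ T : Prop, o ≤ k → (k ≤ h → T) →
      (wt8 h k = 0 ∨ (T ∧ o = h ∧ wt8 h k = 1) ∨ (T ∧ o < h ∧ wt8 h k ≤ 2)) := by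
    intro k T hk hT
    unfold wt8
    rcases lt_trichotomy k h with hlt | heq | hgt
    · right; right
      exact ⟨hT hlt.le, hk.trans_lt hlt, by simp [hlt]⟩
    · right
      rcases l0.eq_or_lt with e | e
      · left; exact ⟨hT heq.le, e, by simp [heq]⟩
      · right; exact ⟨hT heq.le, e, by simp [heq]⟩
    · left; simp [hgt.not_gt, hgt.ne']
  have k1 := key h1 T1 l1 t1
  have k2 := key h2 T2 l2 t2
  have k3 := key h3 T3 l3 t3
  have k4 := key h4 T4 l4 t4
  clear key t1 t2 t3 t4
  rcases l0.eq_or_lt with e | e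
  · have e' : ¬ o < h := e.not_lt
    simp only [e, lt_self_iff_false, false_and, and_false, or_false, true_and, true_implies] at *
    by_cases T1 <;> by_cases T2 <;> by_cases T3 <;> by_cases T4 <;> simp_all <;> omega
  · have e' : ¬ o = h := e.ne
    simp only [e, e', false_and, and_false, false_or, true_and, true_implies] at *
    by_cases T1 <;> by_cases T2 <;> by_cases T3 <;> by_cases T4 <;> simp_all <;> omega

lemma geom8 {K Γ : Type*} [Field K] [LinearOrderedCommGroupWithZero Γ] (w : Valuation K Γ)
    (s : K) (hs : 1 < w s) (x y l3 l4 h : _) (hl3 : l3 = x + y + 1)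
    (hl4 : l4 = x + s⁻¹ * y + s⁻¹ ^ 2) (hh : h = max 1 (max (w x) (w y))) :
    let T : K → Prop := fun p => w (s ^ 3 * p) ≤ h
    (w l3 ≤ h ∧ w l4 ≤ h) ∧
    (1 < h → T x → T y → False) ∧ (1 < h → T x → T l3 → False) ∧
    (1 < h → T x → T l4 → False) ∧ (1 < h → T y → T l3 → False) ∧
    (1 < h → T y → T l4 → False) ∧ (1 < h → T l3 → T l4 → False) ∧
    (1 = h → T x → T y → T l3 → False) ∧ (1 = h → T x → T y → T l4 → False) ∧
    (1 = h → T x → T l3 → T l4 → False) ∧ (1 = h → T y → T l3 → T l4 → False) := by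
  intro T
  have hs0 : s ≠ 0 := by rintro rfl; simp at hs
  have hσ : w s⁻¹ < 1 := by rw [map_inv₀]; exact inv_lt_one_of_one_lt₀ hs
  have hσ2 : w (s⁻¹ ^ 2) < 1 := by rw [map_pow]; exact pow_lt_one₀ zero_le' hσ two_ne_zero
  have h1σ : w (1 - s⁻¹) = 1 := Valuation.map_one_sub_of_lt w hσ
  have h1σ2 : w (1 - s⁻¹ ^ 2) = 1 := Valuation.map_one_sub_of_lt w hσ2
  have h1 : 1 ≤ h := hh ▸ le_max_left _ _
  have hx : w x ≤ h := hh ▸ (le_max_left _ _).trans (le_max_right _ _)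
  have hy : w y ≤ h := hh ▸ (le_max_right _ _).trans (le_max_right _ _)
  have h0 : 0 < h := zero_lt_one.trans_le h1
  have small : ∀ p, T p → ∀ c, w c ≤ w s ^ 2 → w (c * p) < h := by
    intro p hp c hc
    by_cases hp0 : p = 0
    · simpa [hp0] using h0
    · have hwp : 0 < w p := (Valuation.pos_iff w).2 hp0
      refine lt_of_lt_of_le ?_ hp
      rw [map_mul, map_mul, map_pow]
      apply mul_lt_mul_of_pos_right _ hwp
      exact hc.trans_lt (pow_lt_pow_right₀ hs (by norm_num))
  have s1 : ∀ p, T p → w p < h := by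
    intro p hp
    have := small p hp 1 (by rw [map_one]; exact one_le_pow₀ hs.le)
    rwa [one_mul] at this
  have ss : ∀ p, T p → w (s * p) < h := by
    intro p hp
    exact small p hp s (le_self_pow₀ hs.le two_ne_zero)
  have ss2 : ∀ p, T p → w (s ^ 2 * p) < h := by
    intro p hp
    exact small p hp (s ^ 2) (by rw [map_pow])
  have sσ : ∀ p, T p → w (s⁻¹ * p) < h := by
    intro p hp
    exact small p hp s⁻¹ (hσ.le.trans (one_le_pow₀ hs.le))
  have fin : 1 < h → w x < h → w y < h → False := by
    intro h1 hx hy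
    exact absurd hh (max_lt h1 (max_lt hx hy)).ne'
  have w1 : w 1 = 1 := map_one w
  refine ⟨⟨?_, ?_⟩, ?_, ?_, ?_, ?_, ?_, ?_, ?_, ?_, ?_, ?_⟩
  · rw [hl3]
    exact w.map_add_le (w.map_add_le hx hy) (w1.le.trans h1)
  · rw [hl4]
    refine w.map_add_le (w.map_add_le hx ?_) (hσ2.le.trans h1)
    rw [map_mul]
    exact (mul_le_of_le_one_left' hσ.le).trans hy
  · intro h1 t1 t2
    exact fin h1 (s1 _ t1) (s1 _ t2)
  · intro h1 t1 t2
    refine fin h1 (s1 _ t1) ?_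
    have : y = l3 - x - 1 := by rw [hl3]; ring
    rw [this]
    exact w.map_sub_lt (w.map_sub_lt (s1 _ t2) (s1 _ t1)) (w1 ▸ h1)
  · intro h1 t1 t2
    refine fin h1 (s1 _ t1) ?_
    have : y = s * l4 - s * x - s⁻¹ := by rw [hl4]; field_simp; ring
    rw [this]
    exact w.map_sub_lt (w.map_sub_lt (ss _ t2) (ss _ t1)) (hσ.trans h1)
  · intro h1 t1 t2
    refine fin h1 ?_ (s1 _ t1)
    have : x = l3 - y - 1 := by rw [hl3]; ring
    rw [this]
    exact w.map_sub_lt (w.map_sub_lt (s1 _ t2) (s1 _ t1)) (w1 ▸ h1)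
  · intro h1 t1 t2
    refine fin h1 ?_ (s1 _ t1)
    have : x = l4 - s⁻¹ * y - s⁻¹ ^ 2 := by rw [hl4]; ring
    rw [this]
    exact w.map_sub_lt (w.map_sub_lt (s1 _ t2) (sσ _ t1)) (hσ2.trans h1)
  · intro h1 t1 t2
    have hy' : w y < h := by
      have e : (1 - s⁻¹) * y = l3 - l4 - (1 - s⁻¹ ^ 2) := by rw [hl3, hl4]; ring
      have : w y = w ((1 - s⁻¹) * y) := by rw [map_mul, h1σ, one_mul]
      rw [this, e]
      exact w.map_sub_lt (w.map_sub_lt (s1 _ t1) (s1 _ t2)) (h1σ2.trans_lt h1)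
    refine fin h1 ?_ hy'
    have : x = l3 - y - 1 := by rw [hl3]; ring
    rw [this]
    exact w.map_sub_lt (w.map_sub_lt (s1 _ t1) hy') (w1 ▸ h1)
  · intro h1 t1 t2 t3
    have e : (1 : K) = l3 - x - y := by rw [hl3]; ring
    have := w.map_sub_lt (w.map_sub_lt (s1 _ t3) (s1 _ t1)) (s1 _ t2)
    rw [← e, w1] at this
    exact this.ne h1
  · intro h1 t1 t2 t3
    have e : (1 : K) = s ^ 2 * l4 - s ^ 2 * x - s * y := by rw [hl4]; field_simp; ring
    have := w.map_sub_lt (w.map_sub_lt (ss2 _ t3) (ss2 _ t1)) (ss _ t2)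
    rw [← e, w1] at this
    exact this.ne h1
  · intro h1 t1 t2 t3
    have e : (1 - s⁻¹ : K) = s * x + (l3 - x) - s * l4 := by rw [hl3, hl4]; field_simp; ring
    have := w.map_sub_lt (w.map_add_lt (ss _ t1) (w.map_sub_lt (s1 _ t2) (s1 _ t1))) (ss _ t3)
    rw [← e, h1σ] at this
    exact this.ne h1
  · intro h1 t1 t2 t3
    have e : (1 - s⁻¹ ^ 2 : K) = l3 - y + s⁻¹ * y - l4 := by rw [hl3, hl4]; ring
    have := w.map_sub_lt (w.map_add_lt (w.map_sub_lt (s1 _ t2) (s1 _ t1)) (sσ _ t1)) (s1 _ t3)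
    rw [← e, h1σ2] at this
    exact this.ne h1

lemma lift8 {K : Type*} [Field K] (v : K → ℝ) (hv : IsNAVal v) (m : ℕ) (ε : ℝ)
    (hε0 : 0 < ε) (hε1 : ε ≤ 1) (P : Matrix (Fin 2) (Fin 2) K) (τ : Fin 2 → K)
    (hP : ∀ i j, v (P i j - (1 : Matrix (Fin 2) (Fin 2) K) i j) ≤ ε) (hdet : P.det = 1)
    (hτ : ∀ i, v (τ i) ≤ ε) :
    ∃ f : (Fin (2 + m) → K) → Fin (2 + m) → K, MemSAe v ε f ∧ Function.Injective f ∧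
      ∀ z, f z (Fin.castAdd m 0) =
          P 0 0 * z (Fin.castAdd m 0) + P 0 1 * z (Fin.castAdd m 1) + τ 0 ∧
        f z (Fin.castAdd m 1) =
          P 1 0 * z (Fin.castAdd m 0) + P 1 1 * z (Fin.castAdd m 1) + τ 1 := by
  obtain ⟨v0, v1, vn, vinv, vp, vz, va⟩ := val_basic8 v hv
  obtain ⟨h0, hz, hm, ha⟩ := hv
  let A : Matrix (Fin (2 + m)) (Fin (2 + m)) K :=
    Matrix.reindex finSumFinEquiv finSumFinEquiv (Matrix.fromBlocks P 0 0 1)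
  let τ' : Fin (2 + m) → K := Fin.append τ 0
  have hA1 : ∀ i j, v (A i j - (1 : Matrix (Fin (2 + m)) (Fin (2 + m)) K) i j) ≤ ε := by
    have e1 : (1 : Matrix (Fin (2 + m)) (Fin (2 + m)) K) =
        Matrix.reindex finSumFinEquiv finSumFinEquiv (Matrix.fromBlocks 1 0 0 1) := by simp
    intro i j
    rw [e1]
    simp only [A, Matrix.reindex_apply, Matrix.submatrix_apply]
    rcases finSumFinEquiv.symm i with i | i <;> rcases finSumFinEquiv.symm j with j | j
    · simpa using hP i j
    · simpa [v0] using hε0.le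
    · simpa [v0] using hε0.le
    · simpa [v0] using hε0.le
  have hone : ∀ i j, v ((1 : Matrix (Fin (2 + m)) (Fin (2 + m)) K) i j) ≤ 1 := by
    intro i j
    rw [Matrix.one_apply]
    split_ifs
    · exact v1.le
    · rw [v0]; exact zero_le_one
  have hAdet : A.det = 1 := by
    simp only [A, Matrix.det_reindex_self]
    rw [Matrix.det_fromBlocks_zero₂₁, hdet]; simp
  have hτ' : ∀ i, v (τ' i) ≤ ε := by
    intro i
    refine Fin.addCases (fun i => ?_) (fun i => ?_) i
    · simpa [τ'] using hτ i
    · simpa [τ', v0] using hε0.le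
  refine ⟨fun z => A.mulVec z + τ', ⟨A, τ', ?_, hAdet, hA1, fun i => (hτ' i).trans hε1, hτ',
    fun x => rfl⟩, ?_, ?_⟩
  · intro i j
    have := ha (A i j - (1 : Matrix (Fin (2 + m)) (Fin (2 + m)) K) i j)
      ((1 : Matrix (Fin (2 + m)) (Fin (2 + m)) K) i j)
    rw [sub_add_cancel] at this
    exact this.trans (max_le ((hA1 i j).trans hε1) (hone i j))
  · have hu : IsUnit A := (Matrix.isUnit_iff_isUnit_det A).2 (by rw [hAdet]; exact isUnit_one)
    intro z z' hzz
    exact Matrix.mulVec_injective_of_isUnit hu (add_right_cancel hzz)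
  · intro z
    constructor <;>
    simp [A, τ', Matrix.mulVec, dotProduct, Fin.sum_univ_add, Matrix.fromBlocks]

lemma maps8 {K : Type*} [Field K] (v : K → ℝ) (hv : IsNAVal v) (m : ℕ) (ε : ℝ)
    (hε0 : 0 < ε) (hε1 : ε ≤ 1) (s : K) (hs1 : v s < 1) (hsε : v s ≤ ε) (hs0 : s ≠ 0) :
    ∃ a b : (Fin (2 + m) → K) → Fin (2 + m) → K, MemSAe v ε a ∧ MemSAe v ε b ∧
      MemSAe v ε (id : (Fin (2 + m) → K) → Fin (2 + m) → K) ∧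
      Function.Injective a ∧ Function.Injective b ∧
      ∀ z, ∃ x y x1 y1 x2 y2 : K, x = z (Fin.castAdd m 0) ∧ y = z (Fin.castAdd m 1) ∧
        x1 = a z (Fin.castAdd m 0) ∧ y1 = a z (Fin.castAdd m 1) ∧
        x2 = b z (Fin.castAdd m 0) ∧ y2 = b z (Fin.castAdd m 1) ∧
        x1 = (1 + s ^ 3) * x ∧ (1 + s ^ 3) * y1 = y ∧
        x2 + y2 + 1 = (1 + s ^ 3) * (x + y + 1) ∧
        (1 + s ^ 3) * (x2 + s⁻¹ * y2 + s⁻¹ ^ 2) = x + s⁻¹ * y + s⁻¹ ^ 2 := by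
  have hv' := hv
  obtain ⟨v0, v1, vn, vinv, vp, vz, va⟩ := val_basic8 v hv
  obtain ⟨h0, hz, hm, ha⟩ := hv
  let D : Subring K :=
    { carrier := {x | v x ≤ 1}
      mul_mem' := fun {x y} hx hy => by
        change v (x * y) ≤ 1
        rw [hm]; exact mul_le_one₀ hx (h0 _) hy
      one_mem' := v1.le
      add_mem' := fun {x y} hx hy => (ha x y).trans (max_le hx hy)
      zero_mem' := by change v 0 ≤ 1; rw [v0]; exact zero_le_one
      neg_mem' := fun {x} hx => by change v (-x) ≤ 1; rw [vn]; exact hx }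
  have hD : ∀ d ∈ D, ∀ c, c = s * d → v c ≤ ε := by
    rintro d hd _ rfl
    rw [hm]
    have hd : v d ≤ 1 := hd
    have := h0 s
    nlinarith
  have hsD : s ∈ D := hs1.le
  have hl1 : v (1 + s ^ 3) = 1 := va _ (by rw [vp]; exact pow_lt_one₀ (h0 _) hs1 (by norm_num))
  have hr1 : v (s - 1) = 1 := by
    rw [← vn, neg_sub, sub_eq_add_neg]; exact va _ (by rw [vn]; exact hs1)
  have hl0 : (1 + s ^ 3) ≠ 0 := fun h => by rw [h, v0] at hl1; exact zero_ne_one hl1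
  have hr0 : (s - 1) ≠ 0 := fun h => by rw [h, v0] at hr1; exact zero_ne_one hr1
  obtain ⟨μ, hμ⟩ : ∃ μ, μ = (1 + s ^ 3)⁻¹ := ⟨_, rfl⟩
  obtain ⟨ρ, hρ⟩ : ∃ ρ, ρ = (s - 1)⁻¹ := ⟨_, rfl⟩
  have hμD : μ ∈ D := by change v μ ≤ 1; rw [hμ, vinv, hl1, inv_one]
  have hρD : ρ ∈ D := by change v ρ ≤ 1; rw [hρ, vinv, hr1, inv_one]
  have hμe : μ * (1 + s ^ 3) = 1 := by rw [hμ]; exact inv_mul_cancel₀ hl0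
  have hρe : ρ * (s - 1) = 1 := by rw [hρ]; exact inv_mul_cancel₀ hr0
  have sp : ∀ k : ℕ, s ^ k ∈ D := fun k => pow_mem hsD k
  let Y0 : K := s ^ 3 * ρ * (1 + μ)
  let Y1 : K := ρ * (s ^ 3 + s ^ 2 * μ)
  let Y2 : K := ρ * (s ^ 3 + s * μ)
  have hY0 : Y0 ∈ D := mul_mem (mul_mem (sp _) hρD) (add_mem (one_mem _) hμD)
  have hY1 : Y1 ∈ D := mul_mem hρD (add_mem (sp _) (mul_mem (sp _) hμD))
  have hY2 : Y2 ∈ D := mul_mem hρD (add_mem (sp _) (mul_mem hsD hμD))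
  obtain ⟨a, ha1, ha2, ha3⟩ := lift8 v hv' m ε hε0 hε1 !![1 + s ^ 3, 0; 0, μ] ![0, 0] (by
      intro i j
      fin_cases i <;> fin_cases j
      · exact hD _ (sp 2) _ (by simp; ring)
      · exact hD 0 (zero_mem _) _ (by simp)
      · exact hD 0 (zero_mem _) _ (by simp)
      · exact hD (-(s ^ 2 * μ)) (neg_mem (mul_mem (sp 2) hμD)) _ (by
          simp; linear_combination hμe))
    (by simp [Matrix.det_fin_two]; linear_combination hμe)
    (by intro i; fin_cases i <;> simpa [v0] using hε0.le)
  obtain ⟨b, hb1, hb2, hb3⟩ := lift8 v hv' m ε hε0 hε1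
    !![1 + s ^ 3 - s * Y0, s ^ 3 - s * Y1; s * Y0, 1 + s * Y1] ![s ^ 3 - s * Y2, s * Y2] (by
      intro i j
      fin_cases i <;> fin_cases j
      · exact hD (s ^ 2 - Y0) (sub_mem (sp 2) hY0) _ (by simp; ring)
      · exact hD (s ^ 2 - Y1) (sub_mem (sp 2) hY1) _ (by simp; ring)
      · exact hD Y0 hY0 _ (by simp)
      · exact hD Y1 hY1 _ (by simp))
    (by
      simp only [Matrix.det_fin_two, Matrix.of_apply, Matrix.cons_val', Matrix.cons_val_zero,
        Matrix.cons_val_one, Matrix.cons_val_fin_one, Y0, Y1]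
      rw [hμ, hρ]
      field_simp
      ring)
    (by
      intro i
      fin_cases i
      · exact hD (s ^ 2 - Y2) (sub_mem (sp 2) hY2) _ (by simp; ring)
      · exact hD Y2 hY2 _ (by simp))
  refine ⟨a, b, ha1, hb1, ⟨1, 0, ?_, by simp, ?_, ?_, ?_, ?_⟩, ha2, hb2, ?_⟩
  · intro i j
    rw [Matrix.one_apply]
    split_ifs
    · exact v1.le
    · rw [v0]; exact zero_le_one
  · intro i j; rw [sub_self, v0]; exact hε0.le
  · intro i; simp [v0]
  · intro i; simpa [v0] using hε0.le
  · intro x; simp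
  · intro z
    refine ⟨_, _, _, _, _, _, rfl, rfl, rfl, rfl, rfl, rfl, ?_, ?_, ?_, ?_⟩
    · rw [(ha3 z).1]; simp
    · rw [(ha3 z).2]; simp
      linear_combination z (Fin.castAdd m 1) * hμe
    · rw [(hb3 z).1, (hb3 z).2]; simp; ring
    · rw [(hb3 z).1, (hb3 z).2]
      simp only [Matrix.of_apply, Matrix.cons_val', Matrix.cons_val_zero,
        Matrix.cons_val_one, Matrix.cons_val_fin_one, Y0, Y1, Y2]
      rw [hμ, hρ]
      field_simp
      ring

end StatementEightAux

theorem statement8 {K : Type*} [Field K] (v : K → ℝ) (hv : IsNAVal v)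
    (hnt : ∃ x : K, x ≠ 0 ∧ v x ≠ 1)
    (n : ℕ) (hn : 2 ≤ n) (ε : ℝ) (hε0 : 0 < ε) (hε1 : ε ≤ 1)
    (E : Set (Fin n → K)) (hne : E.Nonempty)
    -- E is invariant under SA(n, D_K, ε)
    (hinv : ∀ f : (Fin n → K) → Fin n → K, MemSAe v ε f → f '' E = E) :
    ParadoxicalUsing {f | MemSAe v ε f} E 4 := by
  obtain ⟨m, rfl⟩ := Nat.exists_eq_add_of_le hn
  obtain ⟨s, hs1, hsε, hsI⟩ := exists_s8 v hv hnt ε hε0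
  have hs0 : s ≠ 0 := by rintro rfl; exact hsI isIntegral_zero
  obtain ⟨W, hW⟩ := exists_W8 s hsI
  have hws : 1 < W.valuation s := by
    rw [← not_le, W.valuation_le_one_iff]; exact hW
  obtain ⟨a, b, ha, hb, hid, hai, hbi, hab⟩ := maps8 v hv m ε hε0 hε1 s hs1 hsε hs0
  have hwl : W.valuation (1 + s ^ 3) = W.valuation (s ^ 3) := by
    apply Valuation.map_add_eq_of_lt_right
    rw [map_one, map_pow]
    exact one_lt_pow₀ hws (by norm_num)
  have hwl' : ∀ p, W.valuation (s ^ 3 * p) = W.valuation ((1 + s ^ 3) * p) := fun p => by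
    rw [map_mul, map_mul, hwl]
  let h : (Fin (2 + m) → K) → W.ValueGroup := fun z =>
    max 1 (max (W.valuation (z (Fin.castAdd m 0))) (W.valuation (z (Fin.castAdd m 1))))
  have hx : ∀ z, W.valuation (z (Fin.castAdd m 0)) ≤ h z := fun z =>
    (le_max_left _ _).trans (le_max_right _ _)
  have hy : ∀ z, W.valuation (z (Fin.castAdd m 1)) ≤ h z := fun z =>
    (le_max_right _ _).trans (le_max_right _ _)
  have h1 : ∀ z, 1 ≤ h z := fun z => le_max_left _ _
  refine paradox8 _ E h a b hid ha hb hai hbi (hinv a ha) (hinv b hb) ?_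
  intro z za zb hza hzb
  have geo := fun z : Fin (2 + m) → K => geom8 W.valuation s hws (z (Fin.castAdd m 0))
    (z (Fin.castAdd m 1)) _ _ (h z) rfl rfl rfl
  obtain ⟨-, p12, p13, p14, p23, p24, p34, q123, q124, q134, q234⟩ := geo z
  refine wt_sum8 1 (h z) (h (a z)) (h za) (h (b z)) (h zb) _ _ _ _ (h1 _) (h1 _) (h1 _) (h1 _)
    (h1 _) ?_ ?_ ?_ ?_ p12 p13 p14 p23 p24 p34 q123 q124 q134 q234
  · intro hle
    obtain ⟨_, _, _, _, _, _, rfl, rfl, rfl, rfl, rfl, rfl, e1, e2, e3, e4⟩ := hab z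
    rw [hwl', ← e1]
    exact (hx _).trans hle
  · intro hle
    obtain ⟨_, _, _, _, _, _, rfl, rfl, rfl, rfl, rfl, rfl, e1, e2, e3, e4⟩ := hab za
    rw [hza] at e2
    rw [hwl', e2]
    exact (hy _).trans hle
  · intro hle
    obtain ⟨_, _, _, _, _, _, rfl, rfl, rfl, rfl, rfl, rfl, e1, e2, e3, e4⟩ := hab z
    rw [hwl', ← e3]
    exact (geo (b z)).1.1.trans hle
  · intro hle
    obtain ⟨_, _, _, _, _, _, rfl, rfl, rfl, rfl, rfl, rfl, e1, e2, e3, e4⟩ := hab zb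
    rw [hzb] at e4
    rw [hwl', e4]
    exact (geo zb).1.2.trans hle
end

section
/- Let (K,|·|) be a non-Archimedean nontrivially valued field, n ≥ 2, and let ‖·‖ be a non-Archimedean norm on K^n equivalent to the maximum norm ‖·‖_∞. Then K^n is paradoxical using four pieces with respect to the group IA(K^n,‖·‖) of affine isometries of (K^n,‖·‖). -/
/-- `N` is a non-Archimedean norm on the `K`-vector space `X` with respect to the
valuation `v` on `K`. -/
def IsNANorm {K : Type*} [Field K] (v : K → ℝ) {X : Type*} [AddCommGroup X] [Module K X]
    (N : X → ℝ) : Prop :=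
  (∀ x, 0 ≤ N x) ∧ (∀ x, N x = 0 ↔ x = 0) ∧
    (∀ (c : K) (x : X), N (c • x) = v c * N x) ∧ (∀ x y, N (x + y) ≤ max (N x) (N y))

/-- The maximum norm `‖x‖_∞ = max_i v (x i)` on `K^n`. -/
noncomputable def maxNorm {K : Type*} [Field K] (v : K → ℝ) {n : ℕ} (x : Fin n → K) : ℝ :=
  sSup (Set.range fun i => v (x i))

/-- `f ∈ IA(K^n, N)`: `f` is a surjective affine isometry of `(K^n, N)`. -/
def MemIA {K : Type*} [Field K] {n : ℕ} (N : (Fin n → K) → ℝ)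
    (f : (Fin n → K) → Fin n → K) : Prop :=
  (∃ (A : Matrix (Fin n) (Fin n) K) (τ : Fin n → K), ∀ x, f x = A.mulVec x + τ) ∧
    Function.Surjective f ∧ ∀ x y, N (f x - f y) = N (x - y)

def actG {X : Type*} (φ : Bool → Equiv.Perm X) (g : Bool × Bool) : X → X :=
  fun x => if g.2 then φ g.1 x else (φ g.1).symm x

theorem actG_inv {X : Type*} (φ : Bool → Equiv.Perm X) (s i : Bool) (x : X) :
    actG φ (s, !i) (actG φ (s, i) x) = x := by
  cases i <;> simp [actG]

theorem orient {X : Type*} (φ : Bool → Equiv.Perm X) (good : X → Bool × Bool → Prop) (S : X → ℝ)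
    (h1 : ∀ p g1 g2 g3, g1 ≠ g2 → g1 ≠ g3 → g2 ≠ g3 → good p g1 ∨ good p g2 ∨ good p g3)
    (h2 : ∀ p g h, good p g → h ≠ (g.1, !g.2) → good (actG φ g p) h)
    (h3 : ∀ p g, good p g → S p < S (actG φ g p)) :
    ∃ f : X → X × Bool, Function.Bijective f ∧
      ∀ x, x = (f x).1 ∨ x = φ (f x).2 (f x).1 := by
  classical
  have hng : ∀ p g, good p g → ¬ good (actG φ g p) (g.1, !g.2) := by
    intro p g hg hg'
    have a := h3 _ _ hg
    have b := h3 _ _ hg'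
    rw [actG_inv] at b
    linarith
  have hex : ∀ p, ∃ g, good p g := by
    intro p
    rcases h1 p (true, true) (true, false) (false, true) (by decide) (by decide) (by decide)
      with h | h | h <;> exact ⟨_, h⟩
  choose c hc using hex
  -- half edges of an edge
  let half : (X × Bool) × Bool → X × (Bool × Bool) := fun e =>
    if e.2 then (e.1.1, (e.1.2, true)) else (φ e.1.2 e.1.1, (e.1.2, false))
  have half_inj : Function.Injective half := by
    rintro ⟨⟨p, s⟩, i⟩ ⟨⟨p', s'⟩, i'⟩ h
    cases i <;> cases i' <;> simp [half] at h ⊢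
    · obtain ⟨h, rfl⟩ := h
      simpa using h
    · exact h
  let o : X × (Bool × Bool) → X := fun h => if good h.1 h.2 then actG φ h.2 h.1 else h.1
  let F1 : X → X × Bool := fun p =>
    if (c p).2 then (p, (c p).1) else ((φ (c p).1).symm p, (c p).1)
  have hF1 : Function.Injective F1 := by
    intro p q h
    by_contra hpq
    have key : q = actG φ (c p) p ∧ c q = ((c p).1, !(c p).2) := by
      rcases hp : c p with ⟨s, i⟩
      rcases hq : c q with ⟨s', i'⟩
      cases i <;> cases i' <;> simp [F1, hp, hq, actG] at h ⊢
      · obtain ⟨h, rfl⟩ := h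
        exact absurd (by simpa using h) hpq
      · exact ⟨h.1.symm, h.2.symm⟩
      · exact ⟨by rw [h.1, h.2]; simp, h.2.symm⟩
      · exact absurd h.1 hpq
    have := hng p (c p) (hc p)
    rw [← key.1, ← key.2] at this
    exact this (hc q)
  have hfib : ∀ x, ∀ s : Finset ((X × Bool) × Bool), (∀ e ∈ s, o (half e) = x) → s.card ≤ 2 := by
    intro x s hs
    by_contra hcard
    obtain ⟨e1, e2, e3, m1, m2, m3, n12, n13, n23⟩ := Finset.two_lt_card_iff.1 (not_le.1 hcard)
    replace n12 := half_inj.ne n12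
    replace n13 := half_inj.ne n13
    replace n23 := half_inj.ne n23
    replace m1 := hs _ m1
    replace m2 := hs _ m2
    replace m3 := hs _ m3
    generalize half e1 = k1 at *
    generalize half e2 = k2 at *
    generalize half e3 = k3 at *
    -- if one is good then the others are determined
    have key : ∀ k k' : X × (Bool × Bool), o k = x → o k' = x → good k.1 k.2 → k' ≠ k →
        k' = (x, (k.2.1, !k.2.2)) := by
      intro k k' hk hk' hg hne
      simp only [o, hg, if_true] at hk
      by_cases hg' : good k'.1 k'.2
      · simp only [o, hg', if_true] at hk'
        exfalso
        have hgg : k'.2 ≠ k.2 := by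
          intro hh
          apply hne
          have := actG_inv φ k.2.1 k.2.2 k.1
          have t := actG_inv φ k'.2.1 k'.2.2 k'.1
          simp only [Prod.mk.eta] at this t
          rw [hk] at this
          rw [hk', hh] at t
          exact Prod.ext (t.symm.trans this) hh
        have := h2 k.1 k.2 (k'.2.1, !k'.2.2) hg (by
          intro hh
          apply hgg
          simp only [Prod.mk.injEq] at hh
          exact Prod.ext hh.1 (by simpa using hh.2))
        apply hng k'.1 k'.2 hg'
        rw [hk', ← hk]
        exact this
      · simp only [o, hg', if_false] at hk'
        by_contra hcon
        apply hg'
        rw [hk', ← hk]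
        apply h2 _ _ _ hg
        intro hh
        exact hcon (Prod.ext hk' hh)
    by_cases g1 : good k1.1 k1.2
    · exact n23 ((key k1 k2 m1 m2 g1 n12.symm).trans (key k1 k3 m1 m3 g1 n13.symm).symm)
    by_cases g2 : good k2.1 k2.2
    · exact n13 ((key k2 k1 m2 m1 g2 n12).trans (key k2 k3 m2 m3 g2 n23.symm).symm)
    by_cases g3 : good k3.1 k3.2
    · exact n12 ((key k3 k1 m3 m1 g3 n13).trans (key k3 k2 m3 m2 g3 n23).symm)
    simp only [o, g1, g2, g3, if_false] at m1 m2 m3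
    rw [m1] at g1
    rw [m2] at g2
    rw [m3] at g3
    rcases h1 x k1.2 k2.2 k3.2 (fun h => n12 (Prod.ext (m1.trans m2.symm) h))
      (fun h => n13 (Prod.ext (m1.trans m3.symm) h))
      (fun h => n23 (Prod.ext (m2.trans m3.symm) h)) with h | h | h <;> contradiction
  let t : X × Bool → Finset X := fun e => {o (half (e, true)), o (half (e, false))}
  have hall := (Finset.all_card_le_biUnion_card_iff_exists_injective t).1 (by
    intro T
    have := Finset.card_le_mul_card_image (f := fun e => o (half e))
      (T ×ˢ (Finset.univ : Finset Bool)) 2 (by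
        intro x _
        apply hfib x
        intro e he
        exact (Finset.mem_filter.1 he).2)
    have hsub : (T ×ˢ (Finset.univ : Finset Bool)).image (fun e => o (half e)) ⊆ T.biUnion t := by
      intro x hx
      obtain ⟨⟨e, i⟩, he, rfl⟩ := Finset.mem_image.1 hx
      rw [Finset.mem_biUnion]
      refine ⟨e, (Finset.mem_product.1 he).1, ?_⟩
      cases i <;> simp [t]
    have h' := Finset.card_le_card hsub
    rw [Finset.card_product] at this
    simp only [Finset.card_univ, Fintype.card_bool] at this
    omega)
  obtain ⟨F2, hF2, hF2t⟩ := hall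
  refine Function.Embedding.schroeder_bernstein_of_rel hF1 hF2
    (fun x e => x = e.1 ∨ x = φ e.2 e.1) ?_ ?_
  · intro p
    rcases hp : c p with ⟨s, i⟩
    cases i <;> simp [F1, hp]
  · rintro ⟨p, s⟩
    have := hF2t (p, s)
    simp only [t, Finset.mem_insert, Finset.mem_singleton, o, half] at this
    rcases this with h | h
    · by_cases hg : good p (s, true) <;> simp [hg, actG] at h <;> simp [h]
    · by_cases hg : good (φ s p) (s, false) <;> simp [hg, actG] at h <;> simp [h]

theorem paradox_of_orient {X : Type*} (φ : Bool → Equiv.Perm X) (G : Set (X → X))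
    (hid : (id : X → X) ∈ G) (hφ : ∀ s, (φ s : X → X) ∈ G)
    (f : X → X × Bool) (hf : Function.Bijective f)
    (hR : ∀ x, x = (f x).1 ∨ x = φ (f x).2 (f x).1) :
    ParadoxicalUsing G (Set.univ : Set X) 4 := by
  -- tail pieces and head pieces
  let P : Bool → Fin 2 → Set X := fun s =>
    ![{x | (f x).2 = s ∧ (f x).1 ≠ x}, {x | (f x).2 = s ∧ (f x).1 = x}]
  let g : Bool → Fin 2 → X → X := fun s => ![id, φ s]
  have hdis : ∀ s i i', i ≠ i' → Disjoint (P s i) (P s i') := by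
    intro s i i' h
    rw [Set.disjoint_left]
    fin_cases i <;> fin_cases i' <;> simp [P] at h ⊢ <;> tauto
  have hg : ∀ s i, g s i ∈ G := by
    intro s i
    fin_cases i
    · exact hid
    · exact hφ s
  have hdis2 : ∀ s i, ∀ x ∈ P s i, (f x).2 = s := by
    intro s i x hx
    fin_cases i <;> simp [P] at hx <;> exact hx.1
  have hkey : ∀ s, Disjoint (g s 0 '' P s 0) (g s 1 '' P s 1) := by
    intro s
    rw [Set.disjoint_left]
    rintro x ⟨y, ⟨hy1, hy2⟩, rfl⟩ ⟨z, ⟨hz1, hz2⟩, hz⟩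
    simp [g] at hz
    subst hz
    apply hy2
    rcases hR (φ s z) with h | h
    · exact h.symm
    · rw [hy1] at h
      have h' := (φ s).injective h
      have : f (φ s z) = f z := by
        apply Prod.ext
        · rw [← h', hz2]
        · rw [hy1, hz1]
      have := hf.1 this
      rw [← h', this]
  have hdis3 : ∀ s i i', i ≠ i' → Disjoint (g s i '' P s i) (g s i' '' P s i') := by
    intro s i i' h
    fin_cases i <;> fin_cases i' <;> simp at h
    · exact hkey s
    · exact (hkey s).symm
  have hcov : ∀ s, (⋃ i, g s i '' P s i) = Set.univ := by
    intro s
    rw [Set.eq_univ_iff_forall]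
    intro y
    obtain ⟨x, hx⟩ := hf.2 ((φ s).symm y, s)
    rw [Set.mem_iUnion]
    by_cases hxx : (f x).1 = x
    · refine ⟨1, x, ⟨by rw [hx], hxx⟩, ?_⟩
      simp only [g]
      rw [hx] at hxx
      simp [← hxx]
    · refine ⟨0, x, ⟨by rw [hx], hxx⟩, ?_⟩
      rcases hR x with h | h
      · exact absurd h.symm hxx
      · rw [hx] at h
        simpa [g] using h
  refine ⟨2, 2, by norm_num, by norm_num, by norm_num, P true, P false, g true, g false,
    hg true, hg false, fun _ => Set.subset_univ _, fun _ => Set.subset_univ _, hdis true,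
    hdis false, ?_, ?_, hdis3 true, hcov true, hdis3 false, hcov false⟩
  · intro i j
    rw [Set.disjoint_left]
    intro x hx hx'
    have := hdis2 _ _ _ hx
    rw [hdis2 _ _ _ hx'] at this
    cases this
  · rw [Set.eq_univ_iff_forall]
    intro x
    rw [Set.mem_union, Set.mem_iUnion, Set.mem_iUnion]
    have : ∀ s, (f x).2 = s → ∃ i, x ∈ P s i := by
      intro s hs
      by_cases h : (f x).1 = x
      · exact ⟨1, hs, h⟩
      · exact ⟨0, hs, h⟩
    cases hs : (f x).2
    · exact Or.inr (this _ hs)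
    · exact Or.inl (this _ hs)

def coefG {F : Type*} [Field F] (d e : F) : Bool × Bool → F × F × F
  | (true, true) => (1, 0, 0)
  | (true, false) => (0, 1, 0)
  | (false, true) => (1, 1, -1)
  | (false, false) => (1, d, -e)

def linG {F : Type*} [Field F] (k : F × F × F) (x y : F) : F := k.1 * x + k.2.1 * y + k.2.2

def detG {F : Type*} [Field F] (k l : F × F × F) : F := k.1 * l.2.1 - l.1 * k.2.1

theorem det_ne {F : Type*} [Field F] (d e : F) (hd0 : d ≠ 0) (hd1 : d ≠ 1) (g h : Bool × Bool)
    (hgh : g ≠ h) : detG (coefG d e g) (coefG d e h) ≠ 0 := by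
  have h1 : d - 1 ≠ 0 := sub_ne_zero.2 hd1
  have h2 : 1 - d ≠ 0 := sub_ne_zero.2 hd1.symm
  rcases g with ⟨_ | _, _ | _⟩ <;> rcases h with ⟨_ | _, _ | _⟩ <;>
    simp [detG, coefG, hd0, h1, h2] at hgh ⊢

def det3 {F : Type*} [Field F] (k l m : F × F × F) : F :=
  k.2.2 * detG l m - l.2.2 * detG k m + m.2.2 * detG k l

theorem det3_ne {F : Type*} [Field F] (d e : F) (he0 : e ≠ 0) (he1 : e ≠ 1) (hed : e ≠ d)
    (g h k : Bool × Bool) (hgh : g ≠ h) (hgk : g ≠ k) (hhk : h ≠ k) :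
    det3 (coefG d e g) (coefG d e h) (coefG d e k) ≠ 0 := by
  have h1 : e - 1 ≠ 0 := sub_ne_zero.2 he1
  have h3 : e - d ≠ 0 := sub_ne_zero.2 hed
  have key : ∃ z : F, (z = 1 ∨ z = e ∨ z = e - 1 ∨ z = e - d) ∧
    (det3 (coefG d e g) (coefG d e h) (coefG d e k) = z ∨
     det3 (coefG d e g) (coefG d e h) (coefG d e k) = -z) := by
    rcases g with ⟨_ | _, _ | _⟩ <;> rcases h with ⟨_ | _, _ | _⟩ <;>
      rcases k with ⟨_ | _, _ | _⟩ <;> simp at hgh hgk hhk <;>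
      simp only [det3, detG, coefG] <;>
      first
      | (refine ⟨1, by simp, Or.inl ?_⟩; ring1)
      | (refine ⟨1, by simp, Or.inr ?_⟩; ring1)
      | (refine ⟨e, by simp, Or.inl ?_⟩; ring1)
      | (refine ⟨e, by simp, Or.inr ?_⟩; ring1)
      | (refine ⟨e - 1, by simp, Or.inl ?_⟩; ring1)
      | (refine ⟨e - 1, by simp, Or.inr ?_⟩; ring1)
      | (refine ⟨e - d, by simp, Or.inl ?_⟩; ring1)
      | (refine ⟨e - d, by simp, Or.inr ?_⟩; ring1)
  obtain ⟨z, hz, hz'⟩ := key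
  have hz0 : z ≠ 0 := by
    rcases hz with rfl | rfl | rfl | rfl
    · exact one_ne_zero
    · exact he0
    · exact h1
    · exact h3
  rcases hz' with h | h <;> rw [h]
  · exact hz0
  · exact neg_ne_zero.2 hz0

section
variable {F : Type*} [Field F] (A : AbsoluteValue F ℝ)

theorem lin_bd (k : F × F × F) : ∃ C : ℝ, ∀ x y, A (linG k x y) ≤ C * (1 + A x + A y) := by
  refine ⟨A k.1 + A k.2.1 + A k.2.2, fun x y => ?_⟩
  have h1 := A.add_le (k.1 * x + k.2.1 * y) k.2.2
  have h2 := A.add_le (k.1 * x) (k.2.1 * y)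
  rw [A.map_mul, A.map_mul] at h2
  have := A.nonneg x
  have := A.nonneg y
  have := A.nonneg k.1
  have := A.nonneg k.2.1
  have := A.nonneg k.2.2
  unfold linG
  have : 0 ≤ A k.1 * A y := by positivity
  have : 0 ≤ A k.2.1 * A x := by positivity
  have : 0 ≤ A k.2.2 * A x := by positivity
  have : 0 ≤ A k.2.2 * A y := by positivity
  nlinarith

theorem pair_bd (k l : F × F × F) (h : detG k l ≠ 0) :
    ∃ C : ℝ, ∀ x y, 1 + A x + A y ≤ C * (A (linG k x y) + A (linG l x y) + 1) := by
  obtain ⟨C1, h1⟩ := lin_bd A (l.2.1 / detG k l, -k.2.1 / detG k l,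
    (k.2.1 * l.2.2 - l.2.1 * k.2.2) / detG k l)
  obtain ⟨C2, h2⟩ := lin_bd A (-l.1 / detG k l, k.1 / detG k l,
    (l.1 * k.2.2 - k.1 * l.2.2) / detG k l)
  refine ⟨1 + C1 + C2, fun x y => ?_⟩
  have h1 := h1 (linG k x y) (linG l x y)
  have h2 := h2 (linG k x y) (linG l x y)
  have e1 : linG (l.2.1 / detG k l, -k.2.1 / detG k l,
    (k.2.1 * l.2.2 - l.2.1 * k.2.2) / detG k l) (linG k x y) (linG l x y) = x := by
    have : detG k l / detG k l = 1 := div_self h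
    calc _ = (detG k l / detG k l) * x := by simp only [linG, detG]; ring
      _ = x := by rw [this, one_mul]
  have e2 : linG (-l.1 / detG k l, k.1 / detG k l,
    (l.1 * k.2.2 - k.1 * l.2.2) / detG k l) (linG k x y) (linG l x y) = y := by
    have : detG k l / detG k l = 1 := div_self h
    calc _ = (detG k l / detG k l) * y := by simp only [linG, detG]; ring
      _ = y := by rw [this, one_mul]
  rw [e1] at h1
  rw [e2] at h2
  have := A.nonneg (linG k x y)
  have := A.nonneg (linG l x y)
  nlinarith

theorem triple_bd (k l m : F × F × F) (h : detG k l ≠ 0) (h3 : det3 k l m ≠ 0) :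
    ∃ C : ℝ, ∀ x y, 1 + A x + A y ≤ C * (A (linG k x y) + A (linG l x y) + A (linG m x y)) := by
  obtain ⟨C, hC⟩ := pair_bd A k l h
  have hC0 : 0 ≤ C := by
    have := hC 0 0
    have p1 := A.nonneg (linG k 0 0)
    have p2 := A.nonneg (linG l 0 0)
    simp only [map_zero] at this
    by_contra hc
    push Not at hc
    nlinarith
  set c1 := detG l m / det3 k l m
  set c2 := -detG k m / det3 k l m
  set c3 := detG k l / det3 k l m
  refine ⟨C * (1 + A c1 + A c2 + A c3), fun x y => ?_⟩
  have e1 : c1 * linG k x y + c2 * linG l x y + c3 * linG m x y = 1 := by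
    have : det3 k l m / det3 k l m = 1 := div_self h3
    rw [← this]
    simp only [c1, c2, c3, linG, detG, det3]; ring
  have b1 := A.add_le (c1 * linG k x y + c2 * linG l x y) (c3 * linG m x y)
  have b2 := A.add_le (c1 * linG k x y) (c2 * linG l x y)
  rw [e1, A.map_one, A.map_mul c3] at b1
  rw [A.map_mul, A.map_mul] at b2
  have hxy := hC x y
  have q1 := A.nonneg (linG k x y)
  have q2 := A.nonneg (linG l x y)
  have q3 := A.nonneg (linG m x y)
  have r1 := A.nonneg c1
  have r2 := A.nonneg c2
  have r3 := A.nonneg c3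
  generalize A (linG k x y) = K at *
  generalize A (linG l x y) = L at *
  generalize A (linG m x y) = M at *
  refine hxy.trans ?_
  rw [mul_assoc]
  apply mul_le_mul_of_nonneg_left _ hC0
  have := mul_nonneg r1 q2
  have := mul_nonneg r1 q3
  have := mul_nonneg r2 q1
  have := mul_nonneg r2 q3
  have := mul_nonneg r3 q1
  have := mul_nonneg r3 q2
  nlinarith

theorem bd_mono {C C' a b : ℝ} (hC : C ≤ C') (hb : 0 ≤ b) (h : a ≤ C * b) : a ≤ C' * b :=
  h.trans (mul_le_mul_of_nonneg_right hC hb)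

open Filter in
theorem const_bd (d e : F) (hd0 : d ≠ 0) (hd1 : d ≠ 1) (he0 : e ≠ 0) (he1 : e ≠ 1) (hed : e ≠ d) :
    ∃ C : ℝ, 1 ≤ C ∧ (∀ g x y, A (linG (coefG d e g) x y) ≤ C * (1 + A x + A y)) ∧
    (∀ g h, g ≠ h → ∀ x y, 1 + A x + A y ≤
      C * (A (linG (coefG d e g) x y) + A (linG (coefG d e h) x y) + 1)) ∧
    (∀ g h k, g ≠ h → g ≠ k → h ≠ k → ∀ x y, 1 + A x + A y ≤
      C * (A (linG (coefG d e g) x y) + A (linG (coefG d e h) x y) +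
        A (linG (coefG d e k) x y))) := by
  have E1 : ∀ᶠ C : ℝ in atTop, ∀ g, ∀ x y,
      A (linG (coefG d e g) x y) ≤ C * (1 + A x + A y) := by
    rw [eventually_all]
    intro g
    obtain ⟨C, hC⟩ := lin_bd A (coefG d e g)
    filter_upwards [eventually_ge_atTop C] with C' h x y
    exact bd_mono h (by have := A.nonneg x; have := A.nonneg y; linarith) (hC x y)
  have E2 : ∀ᶠ C : ℝ in atTop, ∀ g h, g ≠ h → ∀ x y, 1 + A x + A y ≤
      C * (A (linG (coefG d e g) x y) + A (linG (coefG d e h) x y) + 1) := by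
    rw [eventually_all]
    intro g
    rw [eventually_all]
    intro h
    rw [eventually_all]
    intro hgh
    obtain ⟨C, hC⟩ := pair_bd A _ _ (det_ne d e hd0 hd1 g h hgh)
    filter_upwards [eventually_ge_atTop C] with C' h' x y
    exact bd_mono h' (by
      have := A.nonneg (linG (coefG d e g) x y)
      have := A.nonneg (linG (coefG d e h) x y)
      linarith) (hC x y)
  have E3 : ∀ᶠ C : ℝ in atTop, ∀ g h k, g ≠ h → g ≠ k → h ≠ k → ∀ x y, 1 + A x + A y ≤
      C * (A (linG (coefG d e g) x y) + A (linG (coefG d e h) x y) +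
        A (linG (coefG d e k) x y)) := by
    rw [eventually_all]
    intro g
    rw [eventually_all]
    intro h
    rw [eventually_all]
    intro k
    rw [eventually_all]
    intro hgh
    rw [eventually_all]
    intro hgk
    rw [eventually_all]
    intro hhk
    obtain ⟨C, hC⟩ := triple_bd A _ _ _ (det_ne d e hd0 hd1 g h hgh)
      (det3_ne d e he0 he1 hed g h k hgh hgk hhk)
    filter_upwards [eventually_ge_atTop C] with C' h' x y
    exact bd_mono h' (by
      have := A.nonneg (linG (coefG d e g) x y)
      have := A.nonneg (linG (coefG d e h) x y)
      have := A.nonneg (linG (coefG d e k) x y)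
      linarith) (hC x y)
  obtain ⟨C, a, b, c, d⟩ := ((eventually_ge_atTop (1 : ℝ)).and (E1.and (E2.and E3))).exists
  exact ⟨C, a, b, c, d⟩
end

theorem arith_step {C Λ S S' lg lg' li li' lh' : ℝ} (hC : 1 ≤ C) (hΛ : 6 * C ^ 3 * (C + 1) ≤ Λ)
    (hS : 1 ≤ S) (hgood : S ≤ 3 * C * lg) (hlg' : lg' = Λ * lg) (hli : li ≤ C * S)
    (hli0 : 0 ≤ li) (hli' : li' = Λ⁻¹ * li) (hS' : lg' ≤ C * S') :
    S < S' ∧ (S' ≤ C * (lh' + li' + 1) → 0 ≤ lh' → S' ≤ 3 * C * lh') := by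
  have hC3 : 1 ≤ C ^ 3 := one_le_pow₀ hC
  have hΛ1 : 1 ≤ Λ := by nlinarith
  have h1 : li' ≤ C * S := by
    rw [hli']
    have : Λ⁻¹ ≤ 1 := inv_le_one_of_one_le₀ hΛ1
    nlinarith
  have h2 : Λ * S ≤ 3 * C ^ 2 * S' := by
    have : Λ * S ≤ Λ * (3 * C * lg) := by gcongr
    have : 3 * C * lg' ≤ 3 * C * (C * S') := by gcongr
    rw [hlg'] at this
    nlinarith
  have h3 : 2 * C * (C + 1) * S ≤ S' := by
    have : 6 * C ^ 3 * (C + 1) * S ≤ 3 * C ^ 2 * S' := (by gcongr : _ ≤ Λ * S).trans h2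
    have h4 : 3 * C ^ 2 * (2 * C * (C + 1) * S) ≤ 3 * C ^ 2 * S' := by
      calc _ = 6 * C ^ 3 * (C + 1) * S := by ring
        _ ≤ _ := this
    exact le_of_mul_le_mul_left h4 (by positivity)
  refine ⟨?_, ?_⟩
  · nlinarith [mul_pos (by linarith : 0 < C) (by linarith : 0 < S)]
  · intro h hl
    have : C * (lh' + li' + 1) ≤ C * (lh' + C * S + S) := by gcongr
    nlinarith [mul_nonneg (by linarith : 0 ≤ C) hl]

section
variable {K : Type*} [Field K] (V : AbsoluteValue K ℝ) {n : ℕ}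

theorem le_maxNorm (z : Fin n → K) (i : Fin n) : V (z i) ≤ maxNorm V z :=
  le_csSup (Set.finite_range _).bddAbove ⟨i, rfl⟩

theorem maxNorm_le (i0 : Fin n) (z : Fin n → K) (r : ℝ) (h : ∀ i, V (z i) ≤ r) :
    maxNorm V z ≤ r := by
  refine csSup_le ⟨_, ⟨i0, rfl⟩⟩ ?_
  rintro _ ⟨i, rfl⟩
  exact h i

theorem memIA_of_small (N : (Fin n → K) → ℝ) (hN : IsNANorm V N) (C₁ C₂ : ℝ)
    (hC2 : 0 < C₂)
    (heq : ∀ x : Fin n → K, C₁ * maxNorm V x ≤ N x ∧ N x ≤ C₂ * maxNorm V x)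
    (B : (Fin n → K) →ₗ[K] (Fin n → K)) (τ : Fin n → K) (f : Equiv.Perm (Fin n → K))
    (hf : ∀ p, f p = p + B p + τ) (q : ℝ) (hq : C₂ * q < C₁)
    (hB : ∀ z, maxNorm V (B z) ≤ q * maxNorm V z) : MemIA N f := by
  obtain ⟨N0, N1, N2, N3⟩ := hN
  have hneg : ∀ x, N (-x) = N x := by
    intro x
    have := N2 (-1) x
    simpa using this
  refine ⟨⟨1 + LinearMap.toMatrix' B, τ, fun x => ?_⟩, f.surjective, fun x y => ?_⟩
  · rw [hf, Matrix.add_mulVec, Matrix.one_mulVec, LinearMap.toMatrix'_mulVec]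
  · have e : f x - f y = (x - y) + B (x - y) := by
      rw [hf, hf, map_sub]; abel
    rw [e]
    generalize x - y = z
    by_cases hz : z = 0
    · simp [hz]
    have hNz : 0 < N z := lt_of_le_of_ne (N0 z) (fun h => hz ((N1 z).1 h.symm))
    have hm : 0 < maxNorm V z := by
      have := (heq z).2
      by_contra hc
      push Not at hc
      nlinarith
    have hlt : N (B z) < N z := by
      have h1 := (heq (B z)).2
      have h2 := hB z
      have h3 := (heq z).1
      nlinarith
    apply le_antisymm
    · exact (N3 _ _).trans (max_le le_rfl hlt.le)
    · have := N3 (z + B z) (-(B z))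
      rw [hneg, add_neg_cancel_right] at this
      rcases le_max_iff.1 this with h | h
      · exact h
      · linarith

variable {F : Type*} [Field F] [Algebra F K] (i0 i1 : Fin n)

def linK (k : F × F × F) (p : Fin n → K) : K :=
  algebraMap F K k.1 * p i0 + algebraMap F K k.2.1 * p i1 + algebraMap F K k.2.2

def mapG (k l : F × F × F) (a b : F) (p : Fin n → K) : Fin n → K :=
  p + Pi.single i0 (algebraMap F K (l.2.1 / detG k l * (a - 1)) * linK i0 i1 k p
      - algebraMap F K (k.2.1 / detG k l * (b - 1)) * linK i0 i1 l p)
    + Pi.single i1 (algebraMap F K (k.1 / detG k l * (b - 1)) * linK i0 i1 l p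
      - algebraMap F K (l.1 / detG k l * (a - 1)) * linK i0 i1 k p)

variable {i0 i1}

theorem mapG_i0 (hi : i0 ≠ i1) (k l : F × F × F) (a b : F) (p : Fin n → K) :
    mapG i0 i1 k l a b p i0 = p i0 + (algebraMap F K (l.2.1 / detG k l * (a - 1)) * linK i0 i1 k p
      - algebraMap F K (k.2.1 / detG k l * (b - 1)) * linK i0 i1 l p) := by
  simp [mapG, hi]

theorem mapG_i1 (hi : i0 ≠ i1) (k l : F × F × F) (a b : F) (p : Fin n → K) :
    mapG i0 i1 k l a b p i1 = p i1 + (algebraMap F K (k.1 / detG k l * (b - 1)) * linK i0 i1 l p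
      - algebraMap F K (l.1 / detG k l * (a - 1)) * linK i0 i1 k p) := by
  simp [mapG, hi.symm]

theorem linK_mapG_fst (hi : i0 ≠ i1) (k l : F × F × F) (h : detG k l ≠ 0) (a b : F)
    (p : Fin n → K) : linK i0 i1 k (mapG i0 i1 k l a b p) = algebraMap F K a * linK i0 i1 k p := by
  have hd : algebraMap F K (detG k l) ≠ 0 := by simpa using h
  have hD : algebraMap F K (detG k l) = algebraMap F K k.1 * algebraMap F K l.2.1
    - algebraMap F K l.1 * algebraMap F K k.2.1 := by simp [detG]
  have hc := mul_inv_cancel₀ hd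
  rw [linK, mapG_i0 hi, mapG_i1 hi]
  simp only [map_mul, map_inv₀, map_sub, map_one, div_eq_mul_inv]
  generalize (algebraMap F K (detG k l))⁻¹ = c at *
  rw [hD] at hc
  simp only [linK]
  linear_combination (algebraMap F K a - 1) * (algebraMap F K k.1 * p i0 +
    algebraMap F K k.2.1 * p i1 + algebraMap F K k.2.2) * hc

theorem linK_mapG_snd (hi : i0 ≠ i1) (k l : F × F × F) (h : detG k l ≠ 0) (a b : F)
    (p : Fin n → K) : linK i0 i1 l (mapG i0 i1 k l a b p) = algebraMap F K b * linK i0 i1 l p := by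
  have hd : algebraMap F K (detG k l) ≠ 0 := by simpa using h
  have hD : algebraMap F K (detG k l) = algebraMap F K k.1 * algebraMap F K l.2.1
    - algebraMap F K l.1 * algebraMap F K k.2.1 := by simp [detG]
  have hc := mul_inv_cancel₀ hd
  rw [linK, mapG_i0 hi, mapG_i1 hi]
  simp only [map_mul, map_inv₀, map_sub, map_one, div_eq_mul_inv]
  generalize (algebraMap F K (detG k l))⁻¹ = c at *
  rw [hD] at hc
  simp only [linK]
  linear_combination (algebraMap F K b - 1) * (algebraMap F K l.1 * p i0 +
    algebraMap F K l.2.1 * p i1 + algebraMap F K l.2.2) * hc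

theorem mapG_mapG (hi : i0 ≠ i1) (k l : F × F × F) (h : detG k l ≠ 0) (a b a' b' : F)
    (ha : a' * a = 1) (hb : b' * b = 1) (p : Fin n → K) :
    mapG i0 i1 k l a' b' (mapG i0 i1 k l a b p) = p := by
  have ha' : algebraMap F K a' * algebraMap F K a = 1 := by rw [← map_mul, ha, map_one]
  have hb' : algebraMap F K b' * algebraMap F K b = 1 := by rw [← map_mul, hb, map_one]
  funext j
  by_cases h0 : j = i0
  · subst h0
    rw [mapG_i0 hi, linK_mapG_fst hi k l h, linK_mapG_snd hi k l h, mapG_i0 hi]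
    simp only [map_mul, map_sub, map_one]
    linear_combination algebraMap F K (l.2.1 / detG k l) * linK j i1 k p * ha' -
      algebraMap F K (k.2.1 / detG k l) * linK j i1 l p * hb'
  by_cases h1 : j = i1
  · subst h1
    rw [mapG_i1 hi, linK_mapG_fst hi k l h, linK_mapG_snd hi k l h, mapG_i1 hi]
    simp only [map_mul, map_sub, map_one]
    linear_combination algebraMap F K (k.1 / detG k l) * linK i0 j l p * hb' -
      algebraMap F K (l.1 / detG k l) * linK i0 j k p * ha'
  · simp [mapG, h0, h1]

def permG (hi : i0 ≠ i1) (k l : F × F × F) (h : detG k l ≠ 0) (a : F) (ha : a ≠ 0) :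
    Equiv.Perm (Fin n → K) where
  toFun := mapG i0 i1 k l a a⁻¹
  invFun := mapG i0 i1 k l a⁻¹ a
  left_inv p := mapG_mapG hi k l h _ _ _ _ (inv_mul_cancel₀ ha) (mul_inv_cancel₀ ha) p
  right_inv p := mapG_mapG hi k l h _ _ _ _ (mul_inv_cancel₀ ha) (inv_mul_cancel₀ ha) p

theorem memIA_permG (hV : ∀ x y, V (x + y) ≤ max (V x) (V y))
    (N : (Fin n → K) → ℝ) (hN : IsNANorm V N) (C₁ C₂ : ℝ)
    (hC2 : 0 < C₂)
    (heq : ∀ x : Fin n → K, C₁ * maxNorm V x ≤ N x ∧ N x ≤ C₂ * maxNorm V x)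
    (hi : i0 ≠ i1) (k l : F × F × F) (h : detG k l ≠ 0) (a : F) (ha : a ≠ 0) (Q ε : ℝ)
    (hε : 0 < ε)
    (hQ : V (algebraMap F K k.1) ≤ Q ∧ V (algebraMap F K k.2.1) ≤ Q ∧
      V (algebraMap F K l.1) ≤ Q ∧ V (algebraMap F K l.2.1) ≤ Q ∧
      V (algebraMap F K (k.1 / detG k l)) ≤ Q ∧ V (algebraMap F K (k.2.1 / detG k l)) ≤ Q ∧
      V (algebraMap F K (l.1 / detG k l)) ≤ Q ∧ V (algebraMap F K (l.2.1 / detG k l)) ≤ Q)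
    (h1 : V (algebraMap F K a - 1) ≤ ε) (h2 : V (algebraMap F K a⁻¹ - 1) ≤ ε)
    (hq : C₂ * (Q * ε * Q) < C₁) :
    MemIA N (permG (K := K) hi k l h a ha) := by
  obtain ⟨q1, q2, q3, q4, q5, q6, q7, q8⟩ := hQ
  have hQ0 : 0 ≤ Q := (V.nonneg _).trans q1
  let lk : F × F × F → (Fin n → K) →ₗ[K] K := fun k =>
    algebraMap F K k.1 • LinearMap.proj i0 + algebraMap F K k.2.1 • LinearMap.proj i1
  have hlk : ∀ k p, linK i0 i1 k p = lk k p + algebraMap F K k.2.2 := by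
    intro k p
    simp [linK, lk, Algebra.smul_def]
  let X : (Fin n → K) →ₗ[K] K := algebraMap F K (l.2.1 / detG k l * (a - 1)) • lk k
      - algebraMap F K (k.2.1 / detG k l * (a⁻¹ - 1)) • lk l
  let Y : (Fin n → K) →ₗ[K] K := algebraMap F K (k.1 / detG k l * (a⁻¹ - 1)) • lk l
      - algebraMap F K (l.1 / detG k l * (a - 1)) • lk k
  let τ : Fin n → K := Pi.single i0 (algebraMap F K (l.2.1 / detG k l * (a - 1)) *
        algebraMap F K k.2.2
      - algebraMap F K (k.2.1 / detG k l * (a⁻¹ - 1)) * algebraMap F K l.2.2)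
    + Pi.single i1 (algebraMap F K (k.1 / detG k l * (a⁻¹ - 1)) * algebraMap F K l.2.2
      - algebraMap F K (l.1 / detG k l * (a - 1)) * algebraMap F K k.2.2)
  let B : (Fin n → K) →ₗ[K] (Fin n → K) :=
    (LinearMap.single K (fun _ => K) i0).comp X + (LinearMap.single K (fun _ => K) i1).comp Y
  have hsub : ∀ x y r, V x ≤ r → V y ≤ r → V (x - y) ≤ r := by
    intro x y r hx hy
    rw [sub_eq_add_neg]
    exact (hV _ _).trans (max_le hx (by rwa [V.map_neg]))
  have hlkb : ∀ k : F × F × F, V (algebraMap F K k.1) ≤ Q → V (algebraMap F K k.2.1) ≤ Q →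
      ∀ z, V (lk k z) ≤ Q * maxNorm V z := by
    intro k b1 b2 z
    simp only [lk, LinearMap.add_apply, LinearMap.smul_apply, LinearMap.proj_apply, smul_eq_mul]
    refine (hV _ _).trans (max_le ?_ ?_) <;> rw [V.map_mul] <;>
      exact mul_le_mul (by assumption) (le_maxNorm V z _) (V.nonneg _) hQ0
  have hco : ∀ (c e : F) (y : K) (z : Fin n → K), V (algebraMap F K c) ≤ Q →
      V (algebraMap F K e - 1) ≤ ε → V y ≤ Q * maxNorm V z →
      V (algebraMap F K (c * (e - 1)) * y) ≤ Q * ε * Q * maxNorm V z := by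
    intro c e y z hc he hy
    rw [V.map_mul, RingHom.map_mul, RingHom.map_sub, RingHom.map_one, V.map_mul,
      mul_assoc (Q * ε)]
    exact mul_le_mul (mul_le_mul hc he (V.nonneg _) hQ0) hy (V.nonneg _) (by positivity)
  refine memIA_of_small V N hN C₁ C₂ hC2 heq B τ _ ?_ (Q * ε * Q) hq ?_
  · intro p
    show mapG i0 i1 k l a a⁻¹ p = _
    funext j
    simp only [mapG, hlk, B, τ, X, Y, Pi.add_apply, LinearMap.add_apply, LinearMap.comp_apply,
      LinearMap.coe_single, LinearMap.sub_apply, LinearMap.smul_apply, smul_eq_mul]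
    by_cases h0 : j = i0
    · subst h0
      simp [hi]
      ring
    by_cases h1 : j = i1
    · subst h1
      simp [h0]
      ring
    · simp [h0, h1]
  · intro z
    have hX : V (X z) ≤ Q * ε * Q * maxNorm V z :=
      hsub _ _ _ (hco _ _ _ _ q8 h1 (hlkb k q1 q2 z)) (hco _ _ _ _ q6 h2 (hlkb l q3 q4 z))
    have hY : V (Y z) ≤ Q * ε * Q * maxNorm V z :=
      hsub _ _ _ (hco _ _ _ _ q5 h2 (hlkb l q3 q4 z)) (hco _ _ _ _ q7 h1 (hlkb k q1 q2 z))
    apply maxNorm_le V i0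
    intro j
    have hBz : B z j = (Pi.single i0 (X z) : Fin n → K) j + (Pi.single i1 (Y z) : Fin n → K) j := by
      simp [B]
    rw [hBz]
    by_cases h0 : j = i0
    · subst h0
      simpa [hi] using hX
    by_cases h1 : j = i1
    · subst h1
      simpa [h0] using hY
    · simp only [Pi.single_apply, h0, h1, if_false, add_zero, map_zero]
      exact (V.nonneg _).trans hX
end

open Filter in
theorem core {F K : Type*} [Field F] [Field K] [Algebra F K] (A : AbsoluteValue F ℝ)
    (V : AbsoluteValue K ℝ) (hV : ∀ x y, V (x + y) ≤ max (V x) (V y))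
    (hI : ∀ ε : ℝ, 0 < ε → ∀ M : ℝ, ∃ a : F, a ≠ 0 ∧ M ≤ A a ∧
      V (algebraMap F K a - 1) ≤ ε ∧ V (algebraMap F K a⁻¹ - 1) ≤ ε)
    (n : ℕ) (hn : 2 ≤ n) (N : (Fin n → K) → ℝ) (hN : IsNANorm V N)
    (heq : ∃ C₁ C₂ : ℝ, 0 < C₁ ∧ 0 < C₂ ∧
      ∀ x : Fin n → K, C₁ * maxNorm V x ≤ N x ∧ N x ≤ C₂ * maxNorm V x) :
    ParadoxicalUsing {f | MemIA N f} (Set.univ : Set (Fin n → K)) 4 := by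
  obtain ⟨C₁, C₂, hC1, hC2, heq⟩ := heq
  obtain ⟨d, -, hd, -⟩ := hI 1 one_pos 2
  obtain ⟨e, -, he, -⟩ := hI 1 one_pos (A d + 1)
  have hA1 := A.map_one
  have hA0 := A.map_zero
  have hd0 : d ≠ 0 := by rintro rfl; linarith
  have hd1 : d ≠ 1 := by rintro rfl; linarith
  have he0 : e ≠ 0 := by rintro rfl; linarith
  have he1 : e ≠ 1 := by rintro rfl; linarith
  have hed : e ≠ d := by rintro rfl; linarith
  obtain ⟨C, hC, B1, B2, B3⟩ := const_bd A d e hd0 hd1 he0 he1 hed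
  have hdet : ∀ s, detG (coefG d e (s, true)) (coefG d e (s, false)) ≠ 0 :=
    fun s => det_ne d e hd0 hd1 _ _ (by simp)
  have hQ : ∀ᶠ Q : ℝ in atTop, ∀ s : Bool,
      V (algebraMap F K (coefG d e (s, true)).1) ≤ Q ∧
      V (algebraMap F K (coefG d e (s, true)).2.1) ≤ Q ∧
      V (algebraMap F K (coefG d e (s, false)).1) ≤ Q ∧
      V (algebraMap F K (coefG d e (s, false)).2.1) ≤ Q ∧
      V (algebraMap F K ((coefG d e (s, true)).1 /
        detG (coefG d e (s, true)) (coefG d e (s, false)))) ≤ Q ∧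
      V (algebraMap F K ((coefG d e (s, true)).2.1 /
        detG (coefG d e (s, true)) (coefG d e (s, false)))) ≤ Q ∧
      V (algebraMap F K ((coefG d e (s, false)).1 /
        detG (coefG d e (s, true)) (coefG d e (s, false)))) ≤ Q ∧
      V (algebraMap F K ((coefG d e (s, false)).2.1 /
        detG (coefG d e (s, true)) (coefG d e (s, false)))) ≤ Q := by
    rw [eventually_all]
    intro s
    simp only [eventually_and]
    refine ⟨?_, ?_, ?_, ?_, ?_, ?_, ?_, ?_⟩ <;> exact eventually_ge_atTop _
  obtain ⟨Q, hQ, hQ1⟩ := (hQ.and (eventually_ge_atTop (1 : ℝ))).exists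
  have hε : 0 < C₁ / (2 * C₂ * Q * Q) := by positivity
  obtain ⟨a, ha, haM, ha1, ha2⟩ := hI _ hε (6 * C ^ 3 * (C + 1))
  have hq : C₂ * (Q * (C₁ / (2 * C₂ * Q * Q)) * Q) < C₁ := by
    have : C₂ * (Q * (C₁ / (2 * C₂ * Q * Q)) * Q) = C₁ / 2 := by
      field_simp
    rw [this]
    linarith
  let i0 : Fin n := ⟨0, by omega⟩
  let i1 : Fin n := ⟨1, by omega⟩
  have hi : i0 ≠ i1 := by simp [i0, i1]
  let φ : Bool → Equiv.Perm (Fin n → K) := fun s => permG hi _ _ (hdet s) a ha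
  obtain ⟨π, hπ⟩ := (Algebra.linearMap F K).exists_leftInverse_of_injective
    (LinearMap.ker_eq_bot.2 (algebraMap F K).injective)
  have hπ1 : ∀ c : F, π (algebraMap F K c) = c := fun c => by
    simpa using LinearMap.congr_fun hπ c
  have hπm : ∀ (c : F) (z : K), π (algebraMap F K c * z) = c * π z := fun c z => by
    rw [← Algebra.smul_def, map_smul, smul_eq_mul]
  let L : Bool × Bool → (Fin n → K) → ℝ := fun g p =>
    A (linG (coefG d e g) (π (p i0)) (π (p i1)))
  have hL : ∀ g p, L g p = A (π (linK i0 i1 (coefG d e g) p)) := by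
    intro g p
    simp only [L, linK, linG, map_add, hπm, hπ1]
  have hL0 : ∀ g p, 0 ≤ L g p := fun g p => A.nonneg _
  have hLg : ∀ g p, L g (actG φ g p) = A a * L g p := by
    rintro ⟨s, i⟩ p
    rw [hL, hL, ← A.map_mul, ← hπm]
    cases i
    · exact congrArg (fun t => A (π t)) (linK_mapG_snd hi _ _ (hdet s) a⁻¹ a p)
    · exact congrArg (fun t => A (π t)) (linK_mapG_fst hi _ _ (hdet s) a a⁻¹ p)
  have hLi : ∀ g p, L (g.1, !g.2) (actG φ g p) = (A a)⁻¹ * L (g.1, !g.2) p := by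
    rintro ⟨s, i⟩ p
    rw [hL, hL, ← map_inv₀, ← A.map_mul, ← hπm]
    cases i
    · exact congrArg (fun t => A (π t)) (linK_mapG_fst hi _ _ (hdet s) a⁻¹ a p)
    · exact congrArg (fun t => A (π t)) (linK_mapG_snd hi _ _ (hdet s) a a⁻¹ p)
  let S : (Fin n → K) → ℝ := fun p => 1 + A (π (p i0)) + A (π (p i1))
  have hS1 : ∀ p, 1 ≤ S p := fun p => by
    have := A.nonneg (π (p i0))
    have := A.nonneg (π (p i1))
    simp only [S]; linarith
  have step : ∀ p g, S p ≤ 3 * C * L g p → S p < S (actG φ g p) ∧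
      ∀ h, h ≠ (g.1, !g.2) → S (actG φ g p) ≤ 3 * C * L h (actG φ g p) := by
    intro p g hg
    have key := fun h => arith_step (lh' := L h (actG φ g p)) hC haM (hS1 p) hg (hLg g p)
      (B1 (g.1, !g.2) _ _) (hL0 _ p) (hLi g p) (B1 g _ _)
    exact ⟨(key g).1, fun h hh => (key h).2 (B2 h _ hh _ _) (hL0 _ _)⟩
  obtain ⟨f, hf, hR⟩ := orient φ (fun p g => S p ≤ 3 * C * L g p) S (by
    intro p g1 g2 g3 h12 h13 h23
    have h : S p ≤ C * (L g1 p + L g2 p + L g3 p) := B3 g1 g2 g3 h12 h13 h23 _ _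
    by_contra hcon
    push Not at hcon
    obtain ⟨c1, c2, c3⟩ := hcon
    nlinarith) (fun p g h hg hh => (step p g hg).2 h hh) (fun p g hg => (step p g hg).1)
  refine paradox_of_orient φ _ ?_ ?_ f hf hR
  · refine ⟨⟨1, 0, fun x => by simp⟩, Function.surjective_id, fun x y => rfl⟩
  · intro s
    exact memIA_permG V hV N hN C₁ C₂ hC2 heq hi _ _ (hdet s) a ha Q _ hε (hQ s) ha1 ha2 hq

section
variable {K : Type*} [Field K] (V : AbsoluteValue K ℝ)

theorem eq_one_of_close (hV : ∀ x y, V (x + y) ≤ max (V x) (V y)) (x : K) (h : V (x - 1) < 1) :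
    V x = 1 := by
  apply le_antisymm
  · have := hV (x - 1) 1
    rw [sub_add_cancel, V.map_one] at this
    exact this.trans (max_le h.le le_rfl)
  · have := hV x (-(x - 1))
    rw [V.map_neg, add_neg_eq_iff_eq_add.2 (by ring : x = 1 + (x - 1)), V.map_one] at this
    rcases le_max_iff.1 this with h' | h'
    · exact h'
    · linarith

theorem interface_of {F : Type*} [Field F] [Algebra F K] (A : AbsoluteValue F ℝ)
    (hV : ∀ x y, V (x + y) ≤ max (V x) (V y)) (c : F) (hc : V (algebraMap F K c) < 1)
    (hA : ∀ m : ℕ, m ≠ 0 → A c ^ m ≤ A (1 + c ^ m)) (hA1 : 1 < A c) :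
    ∀ ε : ℝ, 0 < ε → ∀ M : ℝ, ∃ a : F, a ≠ 0 ∧ M ≤ A a ∧
      V (algebraMap F K a - 1) ≤ ε ∧ V (algebraMap F K a⁻¹ - 1) ≤ ε := by
  intro ε hε M
  obtain ⟨m1, hm1⟩ := exists_pow_lt_of_lt_one hε hc
  obtain ⟨m2, hm2⟩ := pow_unbounded_of_one_lt M hA1
  set m := m1 + m2 + 1
  have hVm : V (algebraMap F K (1 + c ^ m) - 1) = V (algebraMap F K c) ^ m := by
    simp
  have hlt : V (algebraMap F K c) ^ m < 1 := pow_lt_one₀ (V.nonneg _) hc (by omega)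
  have hle : V (algebraMap F K c) ^ m ≤ ε :=
    (pow_le_pow_of_le_one (V.nonneg _) hc.le (by omega : m1 ≤ m)).trans hm1.le
  have h1 : V (algebraMap F K (1 + c ^ m)) = 1 := eq_one_of_close V hV _ (by rw [hVm]; exact hlt)
  have h0 : algebraMap F K (1 + c ^ m) ≠ 0 := by
    intro h
    rw [h, V.map_zero] at h1
    exact zero_ne_one h1
  refine ⟨1 + c ^ m, ?_, ?_, ?_, ?_⟩
  · rintro h
    rw [h, map_zero] at h0
    exact h0 rfl
  · exact (hm2.le.trans (pow_le_pow_right₀ hA1.le (by omega))).trans (hA m (by omega))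
  · rw [hVm]; exact hle
  · have : algebraMap F K (1 + c ^ m)⁻¹ - 1 =
        -((algebraMap F K (1 + c ^ m))⁻¹ * (algebraMap F K (1 + c ^ m) - 1)) := by
      rw [map_inv₀]
      field_simp
      ring
    rw [this, V.map_neg, V.map_mul, hVm, map_inv₀, h1]
    simpa using hle
end

noncomputable def degAbs (k : Type*) [Field k] : AbsoluteValue (RatFunc k) ℝ := by
  classical
  exact
  { toFun := fun x => if x = 0 then 0 else (2 : ℝ) ^ x.intDegree
    map_mul' := by
      intro x y
      by_cases hx : x = 0
      · simp [hx]
      by_cases hy : y = 0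
      · simp [hy]
      simp only [mul_eq_zero, hx, hy, or_self, if_false]
      rw [RatFunc.intDegree_mul hx hy, zpow_add₀ two_ne_zero]
    nonneg' := by
      intro x
      split_ifs
      · exact le_rfl
      · positivity
    eq_zero' := by
      intro x
      by_cases hx : x = 0
      · simp [hx]
      · simp only [hx, if_false, iff_false]
        positivity
    add_le' := by
      intro x y
      by_cases hx : x = 0
      · simp [hx]
      by_cases hy : y = 0
      · simp [hy]
      by_cases hxy : x + y = 0
      · simp only [hxy, if_true, hx, hy, if_false]
        positivity
      simp only [hx, hy, hxy, if_false]
      have h := RatFunc.intDegree_add_le hy hxy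
      rcases le_max_iff.1 h with h | h
      · have := zpow_le_zpow_right₀ (one_le_two : (1 : ℝ) ≤ 2) h
        have : (0 : ℝ) < 2 ^ y.intDegree := by positivity
        linarith
      · have := zpow_le_zpow_right₀ (one_le_two : (1 : ℝ) ≤ 2) h
        have : (0 : ℝ) < 2 ^ x.intDegree := by positivity
        linarith }

theorem degAbs_of_ne {k : Type*} [Field k] (x : RatFunc k) (hx : x ≠ 0) :
    degAbs k x = (2 : ℝ) ^ x.intDegree := by
  classical
  show (if x = 0 then (0 : ℝ) else (2 : ℝ) ^ x.intDegree) = _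
  rw [if_neg hx]

theorem degAbs_X {k : Type*} [Field k] : degAbs k RatFunc.X = 2 := by
  rw [degAbs_of_ne _ RatFunc.X_ne_zero, RatFunc.intDegree_X, zpow_one]

theorem degAbs_one_add {k : Type*} [Field k] (m : ℕ) (hm : m ≠ 0) :
    degAbs k RatFunc.X ^ m ≤ degAbs k (1 + RatFunc.X ^ m) := by
  rw [degAbs_X]
  have e : (1 : RatFunc k) + RatFunc.X ^ m =
      algebraMap (Polynomial k) (RatFunc k) (Polynomial.X ^ m + Polynomial.C 1) := by
    simp [add_comm]
  rw [e, degAbs_of_ne, RatFunc.intDegree_polynomial, Polynomial.natDegree_X_pow_add_C]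
  · simp
  · rw [ne_eq, FaithfulSMul.algebraMap_eq_zero_iff]
    exact Polynomial.X_pow_add_C_ne_zero (Nat.pos_of_ne_zero hm) _

section
variable {K : Type*} [Field K] (V : AbsoluteValue K ℝ)

theorem aeval_ne_of_triv {k : Type*} [Field k] [Algebra k K]
    (hV : ∀ x y, V (x + y) ≤ max (V x) (V y))
    (hk : ∀ x : k, x ≠ 0 → V (algebraMap k K x) = 1) (c : K) (hc0 : c ≠ 0) (hc : V c < 1)
    (p : Polynomial k) : p ≠ 0 → Polynomial.aeval c p ≠ 0 := by
  have hle : ∀ q : Polynomial k, V (Polynomial.aeval c q) ≤ 1 := by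
    intro q
    induction q using Polynomial.induction_on' with
    | add p q hp hq =>
      rw [map_add]
      exact (hV _ _).trans (max_le hp hq)
    | monomial m a =>
      rw [Polynomial.aeval_monomial, V.map_mul, V.map_pow]
      have h1 : V (algebraMap k K a) ≤ 1 := by
        by_cases ha : a = 0
        · simp [ha]
        · exact (hk a ha).le
      exact mul_le_one₀ h1 (pow_nonneg (V.nonneg _) _) (pow_le_one₀ (V.nonneg _) hc.le)
  induction p using Polynomial.recOnHorner with
  | M0 => intro h; exact absurd rfl h
  | MC p a hp0 ha ih =>
    intro _ h
    rw [map_add, Polynomial.aeval_C] at h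
    have h1 : V (Polynomial.aeval c p) = 1 := by
      rw [eq_neg_of_add_eq_zero_left h, V.map_neg, hk a ha]
    have h2 := Polynomial.divX_mul_X_add p
    rw [hp0, map_zero, add_zero] at h2
    rw [← h2, map_mul, Polynomial.aeval_X, V.map_mul] at h1
    have := hle p.divX
    have := V.nonneg c
    nlinarith
  | MX p hp ih =>
    intro _
    rw [map_mul, Polynomial.aeval_X]
    exact mul_ne_zero (ih hp) hc0

theorem final_triv (k : Type*) [Field k] [Algebra k K]
    (hV : ∀ x y, V (x + y) ≤ max (V x) (V y))
    (hk : ∀ x : k, x ≠ 0 → V (algebraMap k K x) = 1) (c : K) (hc0 : c ≠ 0) (hc : V c < 1)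
    (n : ℕ) (hn : 2 ≤ n) (N : (Fin n → K) → ℝ) (hN : IsNANorm V N)
    (heq : ∃ C₁ C₂ : ℝ, 0 < C₁ ∧ 0 < C₂ ∧
      ∀ x : Fin n → K, C₁ * maxNorm V x ≤ N x ∧ N x ≤ C₂ * maxNorm V x) :
    ParadoxicalUsing {f | MemIA N f} (Set.univ : Set (Fin n → K)) 4 := by
  have hinj : Function.Injective (Polynomial.aeval c : Polynomial k →ₐ[k] K).toRingHom := by
    rw [injective_iff_map_eq_zero]
    intro p hp
    by_contra h
    exact aeval_ne_of_triv V hV hk c hc0 hc p h hp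
  let φ : RatFunc k →+* K := RatFunc.liftRingHom (Polynomial.aeval c : Polynomial k →ₐ[k] K).toRingHom
    (nonZeroDivisors_le_comap_nonZeroDivisors_of_injective _ hinj)
  letI := φ.toAlgebra
  have hφ : algebraMap (RatFunc k) K RatFunc.X = c := by
    show φ RatFunc.X = c
    simp only [φ, RatFunc.liftRingHom_X]
    simp
  exact core (degAbs k) V hV (interface_of V (degAbs k) hV RatFunc.X (by rw [hφ]; exact hc)
    (fun m hm => degAbs_one_add m hm) (by rw [degAbs_X]; norm_num)) n hn N hN heq

theorem final_abs (hV : ∀ x y, V (x + y) ≤ max (V x) (V y))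
    (c : K) (hc0 : c ≠ 0) (hc : V c < 1)
    (n : ℕ) (hn : 2 ≤ n) (N : (Fin n → K) → ℝ) (hN : IsNANorm V N)
    (heq : ∃ C₁ C₂ : ℝ, 0 < C₁ ∧ 0 < C₂ ∧
      ∀ x : Fin n → K, C₁ * maxNorm V x ≤ N x ∧ N x ≤ C₂ * maxNorm V x) :
    ParadoxicalUsing {f | MemIA N f} (Set.univ : Set (Fin n → K)) 4 := by
  obtain ⟨p, hp⟩ := CharP.exists K
  rcases CharP.char_is_prime_or_zero K p with hpp | rfl
  · haveI : Fact p.Prime := ⟨hpp⟩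
    letI := ZMod.algebra K p
    refine final_triv V (ZMod p) hV ?_ c hc0 hc n hn N hN heq
    intro x hx
    have h := ZMod.pow_card_sub_one_eq_one hx
    have h2 : V (algebraMap (ZMod p) K x) ^ (p - 1) = 1 := by
      rw [← V.map_pow, ← map_pow, h, map_one, V.map_one]
    exact (pow_eq_one_iff_of_nonneg (V.nonneg _) (by have := hpp.two_le; omega)).1 h2
  · haveI : CharZero K := CharP.charP_to_charZero K
    by_cases hm : ∃ m : ℕ, m ≠ 0 ∧ V (m : K) < 1
    · obtain ⟨m, hm0, hm⟩ := hm
      have hm1 : m ≠ 1 := by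
        rintro rfl
        simp at hm
      have hm2 : (1 : ℝ) < m := by
        have : 1 < m := by omega
        exact_mod_cast this
      refine core Rat.AbsoluteValue.real V hV (interface_of V Rat.AbsoluteValue.real hV (m : ℚ)
        (by simpa using hm) ?_ ?_) n hn N hN heq
      · intro j _
        rw [Rat.AbsoluteValue.real_eq_abs, Rat.AbsoluteValue.real_eq_abs]
        have h0 : (0 : ℚ) ≤ (m : ℚ) := by positivity
        rw [abs_of_nonneg h0, abs_of_nonneg (by positivity)]
        push_cast
        linarith
      · rw [Rat.AbsoluteValue.real_eq_abs]
        simpa using hm2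
    · push Not at hm
      have hle : ∀ m : ℕ, V (m : K) ≤ 1 := by
        intro m
        induction m with
        | zero => simp
        | succ m ih =>
          rw [Nat.cast_succ]
          exact (hV _ _).trans (max_le ih (by simp))
      have h1 : ∀ m : ℕ, m ≠ 0 → V (m : K) = 1 := fun m h => le_antisymm (hle m) (hm m h)
      refine final_triv V ℚ hV ?_ c hc0 hc n hn N hN heq
      intro x hx
      have hnum : V ((x.num : ℤ) : K) = 1 := by
        rcases Int.natAbs_eq x.num with h | h <;> rw [h]
        · rw [Int.cast_natCast]
          exact h1 _ (by simpa using hx)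
        · rw [Int.cast_neg, V.map_neg, Int.cast_natCast]
          exact h1 _ (by simpa using hx)
      rw [eq_ratCast, Rat.cast_def, map_div₀, hnum, h1 _ x.den_ne_zero, div_one]
end

theorem statement9 {K : Type*} [Field K] (v : K → ℝ) (hv : IsNAVal v)
    (hnt : ∃ c : K, c ≠ 0 ∧ v c ≠ 1)
    (n : ℕ) (hn : 2 ≤ n) (N : (Fin n → K) → ℝ) (hN : IsNANorm v N)
    -- N is equivalent to the maximum norm
    (heq : ∃ C₁ C₂ : ℝ, 0 < C₁ ∧ 0 < C₂ ∧
      ∀ x : Fin n → K, C₁ * maxNorm v x ≤ N x ∧ N x ≤ C₂ * maxNorm v x)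
    :
    ParadoxicalUsing {f | MemIA N f} (Set.univ : Set (Fin n → K)) 4 := by
  obtain ⟨v0, v1, v2, v3⟩ := hv
  let V : AbsoluteValue K ℝ :=
    { toFun := v
      map_mul' := v2
      nonneg' := v0
      eq_zero' := v1
      add_le' := fun x y => (v3 x y).trans (max_le (by linarith [v0 y]) (by linarith [v0 x])) }
  obtain ⟨c, hc0, hc⟩ := hnt
  rcases lt_or_gt_of_ne hc with h | h
  · exact final_abs V v3 c hc0 h n hn N hN heq
  · refine final_abs V v3 c⁻¹ (inv_ne_zero hc0) ?_ n hn N hN heq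
    rw [map_inv₀]
    exact inv_lt_one_of_one_lt₀ h
end
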